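/- Let d ≥ 2 and fix p,q ∈ (d/2,∞) satisfying 1/p + 1/q < 2/d, and let ε := 2(2/d − 1/p − 1/q)((d−2)/d + 1/q)^{-1}. For each κ ∈ (0,1] and each ω ∈ Ω_{p,q} there exists c₃(ω) ∈ (0,∞) such that P_ω^x(Y_t^R = y) ≤ c₃(ω) R^{−d} (t/R²)^{−(2+ε)/ε} exp( −(|x−y|₁/(5κR)) log(R²/t) ) π_ω^R(y) holds for all R ≥ 1 with κR ≥ 1, all t ∈ (0,R²), and all x,y ∈ Z^d. -/

import Mathlib

open MeasureTheory Filter Topology Matrix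
open scoped ENNReal NNReal

noncomputable section

namespace DetCond

/-- Vertices of `ℤ^d`. -/
abbrev Vert (d : ℕ) := Fin d → ℤ

/-- Index of the (unordered) nearest-neighbour edge `(x, x + e i)` of `ℤ^d`;
the set of these indices is in natural bijection with `E(ℤ^d)` modulo orientation. -/
abbrev EdgeIx (d : ℕ) := Vert d × Fin d

/-- The space `Ω = (0,∞)^{E(ℤ^d)}` of (symmetric) conductance configurations, with
its product topology and product σ-algebra. -/
abbrev EnvSp (d : ℕ) := {ω : EdgeIx d → ℝ // ∀ e, 0 < ω e}

/-- The `i`-th coordinate unit vector of `ℤ^d`. -/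
def unitv (d : ℕ) (i : Fin d) : Vert d := fun j => if j = i then 1 else 0

/-- The translation `τ_x` acting on environments: `c_{τ_x ω}(y,z) = c_ω(y+x,z+x)`. -/
def shift (d : ℕ) (x : Vert d) (ω : EnvSp d) : EnvSp d :=
  ⟨fun e => ω.1 (e.1 + x, e.2), fun e => ω.2 (e.1 + x, e.2)⟩

/-- The conductance `c_ω(x,y)`; it vanishes when `x,y` are not nearest neighbours
and is symmetric in `x,y` by construction. -/
def cnd (d : ℕ) (ω : EnvSp d) (x y : Vert d) : ℝ :=
  ∑ i, ((if y = x + unitv d i then ω.1 (x, i) else 0) +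
        (if x = y + unitv d i then ω.1 (y, i) else 0))

/-- `π_ω(x) = Σ_{z : (x,z) ∈ E(ℤ^d)} c_ω(x,z)`. -/
def piOf (d : ℕ) (ω : EnvSp d) (x : Vert d) : ℝ :=
  ∑ i, (ω.1 (x, i) + ω.1 (x - unitv d i, i))

/-- The box `Λ_r = [-r,r]^d ∩ ℤ^d`. -/
def box (d : ℕ) (r : ℝ) : Finset (Vert d) :=
  Fintype.piFinset fun _ : Fin d => Finset.Icc ⌈-r⌉ ⌊r⌋

/-- The nearest neighbours of `x` in `ℤ^d`. -/
def nbrs (d : ℕ) (x : Vert d) : Finset (Vert d) :=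
  (Finset.univ.image fun i => x + unitv d i) ∪ (Finset.univ.image fun i => x - unitv d i)

/-- The set `E(Λ)` of edges incident with at least one vertex of `Λ`
(one index per unordered edge). -/
def edgesIn (d : ℕ) (Λ : Finset (Vert d)) : Finset (EdgeIx d) :=
  Λ.biUnion fun x =>
    (Finset.univ.image fun i => (x, i)) ∪ (Finset.univ.image fun i => (x - unitv d i, i))

/-- Bounded functions on `Ω`. -/
def IsBdd (d : ℕ) (f : EnvSp d → ℝ) : Prop := ∃ M, ∀ ω, |f ω| ≤ M

/-- Local functions: `f` depends only on the coordinates in some finite set `B` of edges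
and, viewed as a function of those coordinates, has compact support in `(0,∞)^B`. -/
def IsLocalFn (d : ℕ) (f : EnvSp d → ℝ) : Prop :=
  ∃ B : Finset (EdgeIx d),
    (∀ ω₁ ω₂ : EnvSp d, (∀ e ∈ B, ω₁.1 e = ω₂.1 e) → f ω₁ = f ω₂) ∧
    ∃ a b : ℝ, 0 < a ∧ ∀ ω : EnvSp d, (∃ e ∈ B, ω.1 e < a ∨ b < ω.1 e) → f ω = 0

/-- `ℓ_ω(f) = L`, i.e. the block averages of the translates of `f` converge to `L`. -/
def avgTo (d : ℕ) (ω : EnvSp d) (f : EnvSp d → ℝ) (L : ℝ) : Prop :=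
  Tendsto (fun n : ℕ => (∑ x ∈ box d (n : ℝ), f (shift d x ω)) / ((box d (n : ℝ)).card : ℝ))
    atTop (𝓝 L)

/-- `ω` is averaging: `ℓ_ω(f)` exists for every continuous local `f`. -/
def Averaging (d : ℕ) (ω : EnvSp d) : Prop :=
  ∀ f : EnvSp d → ℝ, Continuous f → IsLocalFn d f → ∃ L, avgTo d ω f L

/-- `ω` is tempered, i.e. `ω ∈ Ω'`. -/
def Tempered (d : ℕ) (ω : EnvSp d) : Prop :=
  Tendsto (fun ε : ℝ =>
      limsup (fun n : ℕ =>
        (∑ e ∈ edgesIn d (box d (n : ℝ)),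
            (if ε ≤ ω.1 e ∧ ω.1 e ≤ ε⁻¹ then (0:ℝ) else 1)) / (n : ℝ) ^ d) atTop)
    (𝓝[>] 0) (𝓝 0)

/-- `P` is the measure `ℙ_ω` associated with an averaging tempered `ω`:
the unique probability measure whose expectation of every bounded continuous function
is the corresponding block-average limit `ℓ_ω(f)`. -/
def IsEnvLaw (d : ℕ) (ω : EnvSp d) (P : Measure (EnvSp d)) : Prop :=
  IsProbabilityMeasure P ∧
    ∀ f : EnvSp d → ℝ, Continuous f → IsBdd d f → avgTo d ω f (∫ ω', f ω' ∂P)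

/-- Ergodicity of a measure on `Ω` with respect to the translations of `ℤ^d`. -/
def ErgodicEnv (d : ℕ) (P : Measure (EnvSp d)) : Prop :=
  ∀ A : Set (EnvSp d), MeasurableSet A → (∀ x : Vert d, shift d x ⁻¹' A = A) →
    P A = 0 ∨ P A = 1

/-- `ω ∈ Ω⋆`: tempered, averaging, and the associated measure `ℙ_ω` is ergodic. -/
def InOmegaStar (d : ℕ) (ω : EnvSp d) : Prop :=
  Tempered d ω ∧ Averaging d ω ∧
    ∀ P : Measure (EnvSp d), IsEnvLaw d ω P → ErgodicEnv d P

/-- `ω ∈ Ω_{p,q}`. -/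
def InOmegaPQ (d : ℕ) (p q : ℝ) (ω : EnvSp d) : Prop :=
  (∃ C : ℝ, ∀ n : ℕ, 1 ≤ n →
      (∑ e ∈ edgesIn d (box d (n : ℝ)), ω.1 e ^ p) / (n : ℝ) ^ d ≤ C) ∧
  (∃ C : ℝ, ∀ n : ℕ, 1 ≤ n →
      (∑ e ∈ edgesIn d (box d (n : ℝ)), ω.1 e ^ (-q)) / (n : ℝ) ^ d ≤ C)

/-- The path space of the discrete-time walk. -/
abbrev Path (d : ℕ) := ℕ → Vert d

/-- One-step transition probabilities `𝖯_ω(x,y) = c_ω(x,y)/π_ω(x)`. -/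
def transP (d : ℕ) (ω : EnvSp d) (x y : Vert d) : ℝ := cnd d ω x y / piOf d ω x

/-- `μ` is the law `P_ω^{x₀}` of the random walk among the conductances `ω`
started at `x₀`: a probability measure on the path space with the prescribed
finite-dimensional (cylinder) probabilities. -/
def IsWalkLaw (d : ℕ) (ω : EnvSp d) (x₀ : Vert d) (μ : Measure (Path d)) : Prop :=
  IsProbabilityMeasure μ ∧
    ∀ (n : ℕ) (γ : ℕ → Vert d),
      μ {w | ∀ k ≤ n, w k = γ k} =
        (if γ 0 = x₀ then 1 else 0) *
          ∏ k ∈ Finset.range n, ENNReal.ofReal (transP d ω (γ k) (γ (k+1)))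

/-- `n`-step transition probabilities of the discrete-time walk. -/
def stepP (d : ℕ) (ω : EnvSp d) : ℕ → Vert d → Vert d → ℝ
  | 0, x, y => if x = y then 1 else 0
  | n+1, x, y => ∑ z ∈ nbrs d x, transP d ω x z * stepP d ω n z y

/-- `P_ω^x(Y_t = y)` for the constant-speed continuous-time walk `Y_t = X_{N(t)}`,
where `N` is an independent rate-1 Poisson process. -/
def ctP (d : ℕ) (ω : EnvSp d) (t : ℝ) (x y : Vert d) : ℝ :=
  ∑' k : ℕ, Real.exp (-t) * t ^ k / (Nat.factorial k : ℝ) * stepP d ω k x y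

/-- The `ℓ¹`-norm of a vertex of `ℤ^d`. -/
def l1 (d : ℕ) (x : Vert d) : ℝ := ∑ i, |(x i : ℝ)|

/-- A vertex of `ℤ^d` regarded as a point of `ℝ^d`. -/
def ivert (d : ℕ) (x : Vert d) : Fin d → ℝ := fun i => (x i : ℝ)

/-- The linearly interpolated diffusively rescaled walk `B^{(n)}`. -/
def BnProc (d : ℕ) (n : ℕ) (w : Path d) (t : ℝ) : Fin d → ℝ :=
  (Real.sqrt n)⁻¹ •
    (ivert d (w ⌊t * n⌋₊) +
      (t * n - (⌊t * n⌋₊ : ℝ)) • (ivert d (w (⌊t * n⌋₊ + 1)) - ivert d (w ⌊t * n⌋₊)))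


/-- The measure `ℚ_ω` obtained from `ℙ_ω` by tilting with `π(0)`. -/
def Qmeas (d : ℕ) (P : Measure (EnvSp d)) : Measure (EnvSp d) :=
  P.withDensity fun ω' => ENNReal.ofReal (piOf d ω' 0 / ∫ ω'', piOf d ω'' 0 ∂P)

/-- The inner product `⟨f,g⟩_{L²(πμ)}`. -/
def innerP (d : ℕ) (P : Measure (EnvSp d)) (f g : EnvSp d → ℝ) : ℝ :=
  ∫ ω', f ω' * g ω' * piOf d ω' 0 ∂P

/-- The Dirichlet pairing `⟨h, (−L)h⟩_{L²(πμ)}`. -/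
def quadL (d : ℕ) (P : Measure (EnvSp d)) (h : EnvSp d → ℝ) : ℝ :=
  ∫ ω', (∑ z ∈ nbrs d 0, cnd d ω' 0 z * (h ω' - h (shift d z ω'))) * h ω' ∂P

/-- The inner product of `L²(ν)`. -/
def innerQ (d : ℕ) (ν : Measure (EnvSp d)) (f g : EnvSp d → ℝ) : ℝ :=
  ∫ ω', f ω' * g ω' ∂ν

/-- The Dirichlet pairing `⟨h, (−L)h⟩_{L²(ν)}`. -/
def quadQ (d : ℕ) (ν : Measure (EnvSp d)) (h : EnvSp d → ℝ) : ℝ :=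
  ∫ ω', ((piOf d ω' 0)⁻¹ *
      ∑ z ∈ nbrs d 0, cnd d ω' 0 z * (h ω' - h (shift d z ω'))) * h ω' ∂ν

/-- The set whose supremum is the variational characterization
`⟨f,(−L)⁻¹f⟩_{L²(ν)} = sup_h [2⟨h,f⟩ − ⟨h,(−L)h⟩]` (over bounded continuous `h`);
`⟨f,(−L)⁻¹f⟩_{L²(ν)} < ∞` means this set is bounded above. -/
def invPairSet (d : ℕ) (ν : Measure (EnvSp d)) (f : EnvSp d → ℝ) : Set ℝ :=
  {r | ∃ h : EnvSp d → ℝ, Continuous h ∧ IsBdd d h ∧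
        r = 2 * innerQ d ν h f - quadQ d ν h}

/-- The function `f(ω) = π_ω(0)⁻¹ ∇⋆(c v)(ω)` built from a vector field `v`. -/
def fDiv (d : ℕ) (v : EnvSp d → Fin d → ℝ) (ω : EnvSp d) : ℝ :=
  (piOf d ω 0)⁻¹ *
    ∑ i, (cnd d ω 0 (unitv d i) * v ω i -
          cnd d ω (-(unitv d i)) 0 * v (shift d (-(unitv d i)) ω) i)

/-- The inner product of `ℓ²(Λ,π_ω)`. -/
def innerF (d : ℕ) (ω : EnvSp d) (Λ : Finset (Vert d)) (f g : Vert d → ℝ) : ℝ :=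
  ∑ x ∈ Λ, f x * g x * piOf d ω x

/-- The pairing `⟨h, (−𝖫_ω)h⟩_{ℓ²(Λ,π_ω)}` for `h` vanishing outside `Λ`. -/
def quadF (d : ℕ) (ω : EnvSp d) (Λ : Finset (Vert d)) (h : Vert d → ℝ) : ℝ :=
  ∑ x ∈ Λ, (∑ z ∈ nbrs d x, cnd d ω x z * (h x - h z)) * h x

/-- `⟨f, (−𝖫_ω)⁻¹_Λ f⟩_{ℓ²(Λ,π_ω)}` via its variational characterization
`sup_h [2⟨h,f⟩ − ⟨h,(−𝖫_ω)h⟩]` over `h ∈ ℓ²(Λ,π_ω)`. -/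
def invPairF (d : ℕ) (ω : EnvSp d) (Λ : Finset (Vert d)) (f : Vert d → ℝ) : ℝ :=
  sSup {r | ∃ h : Vert d → ℝ, (∀ x ∉ Λ, h x = 0) ∧
      r = 2 * innerF d ω Λ h f - quadF d ω Λ h}

/-- The antisymmetric edge function `v∘τ(ω)`: the value assigned to the
edge `(x, x+e_i)` is `v_i(τ_x(ω))`. -/
def efield (d : ℕ) (v : EnvSp d → Fin d → ℝ) (ω : EnvSp d) : Vert d → Fin d → ℝ :=
  fun x i => v (shift d x ω) i

/-- The discrete gradient `∇h` of `h : ℤ^d → ℝ` as an edge function. -/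
def dgradE (d : ℕ) (h : Vert d → ℝ) : Vert d → Fin d → ℝ :=
  fun x i => h (x + unitv d i) - h x

/-- The inner product `⟨u,w⟩_{ℓ²(E(Λ), c_ω)}` of (antisymmetric) edge functions;
each unordered edge is counted once, which agrees with the paper's sum over
ordered edges carrying the factor ½. -/
def einner (d : ℕ) (ω : EnvSp d) (Λ : Finset (Vert d)) (u w : Vert d → Fin d → ℝ) : ℝ :=
  ∑ e ∈ edgesIn d Λ, u e.1 e.2 * w e.1 e.2 * ω.1 e

/-- The Dirichlet energy `𝓔_Λ^ω(v)`. -/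
def direnergy (d : ℕ) (ω : EnvSp d) (Λ : Finset (Vert d)) (v : EnvSp d → Fin d → ℝ) : ℝ :=
  sInf {r | ∃ h : Vert d → ℝ, (∀ x ∉ Λ, h x = 0) ∧
      r = einner d ω Λ (fun x i => efield d v ω x i - dgradE d h x i)
            (fun x i => efield d v ω x i - dgradE d h x i)}

/-- The gradient `∇h` of a function on `Ω`. -/
def gradOmega (d : ℕ) (h : EnvSp d → ℝ) : EnvSp d → Fin d → ℝ :=
  fun ω i => h (shift d (unitv d i) ω) - h ω

/-- The inner product `⟨u, c w⟩_{L²(P,ℝ^d)}`. -/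
def cinnerP (d : ℕ) (P : Measure (EnvSp d)) (u w : EnvSp d → Fin d → ℝ) : ℝ :=
  ∑ i, ∫ ω', cnd d ω' 0 (unitv d i) * u ω' i * w ω' i ∂P

/-- Bounded vector fields on `Ω`. -/
def IsBddV (d : ℕ) (v : EnvSp d → Fin d → ℝ) : Prop := ∃ M, ∀ ω i, |v ω i| ≤ M

/-- The space `𝒱 = (ℝ^d)^{ℤ^d}` of vector fields on `ℤ^d`. -/
abbrev VS (d : ℕ) := Vert d → Fin d → ℝ

/-- The empirical measures `μ_r^{ω,v}` built from the minimizers `h_r` of the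
finite-volume Dirichlet energies. -/
def muR (d : ℕ) (ω : EnvSp d) (hr : ℕ → Vert d → ℝ) (r : ℕ) :
    Measure (EnvSp d × VS d) :=
  (((box d ((r : ℝ) + Real.sqrt r)).card : ℝ≥0∞) *
      ((box d (Real.sqrt r)).card : ℝ≥0∞))⁻¹ •
    ∑ z ∈ box d (Real.sqrt r), ∑ x ∈ box d ((r : ℝ) + Real.sqrt r),
      Measure.dirac (shift d (x + z) ω, fun y => dgradE d (hr r) (x + z + y))

/-- The localized conductances `c_ω^R`. -/
def cR (d : ℕ) (ω : EnvSp d) (R : ℝ) (e : EdgeIx d) : ℝ :=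
  if e ∈ edgesIn d (box d (2 * R)) then ω.1 e else 1

/-- The localized measure `π_ω^R`. -/
def piRloc (d : ℕ) (ω : EnvSp d) (R : ℝ) (x : Vert d) : ℝ :=
  if x ∈ box d (2 * R) then piOf d ω x
  else if x ∈ box d (4 * R) then 1 + piOf d ω x else 1

/-- The localized Dirichlet form `D_ω^R(f,f)` (each unordered edge counted once). -/
def DR (d : ℕ) (ω : EnvSp d) (R : ℝ) (f : Vert d → ℝ) : ℝ≥0∞ :=
  ∑' e : EdgeIx d, ENNReal.ofReal (cR d ω R e * (f (e.1 + unitv d e.2) - f e.1) ^ 2)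

/-- The norm `‖f‖_{ℓ^s(μ)}`. -/
def lpN (d : ℕ) (μw : Vert d → ℝ) (s : ℝ) (f : Vert d → ℝ) : ℝ≥0∞ :=
  (∑' x : Vert d, ENNReal.ofReal (|f x| ^ s * μw x)) ^ (1 / s)

/-- The exponent `ε = 2(2/d − 1/p − 1/q)((d−2)/d + 1/q)⁻¹`. -/
def epsPQ (d : ℕ) (p q : ℝ) : ℝ :=
  2 * (2 / (d : ℝ) - 1 / p - 1 / q) / (((d : ℝ) - 2) / (d : ℝ) + 1 / q)

/-- Jump rates of the localized constant-speed chain `Y^R`: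
rate `c_ω^R(x,y)/π_ω^R(x)` from `x` to `y`. -/
def rateR (d : ℕ) (ω : EnvSp d) (R : ℝ) (x y : Vert d) : ℝ :=
  (∑ i, ((if y = x + unitv d i then cR d ω R (x, i) else 0) +
         (if x = y + unitv d i then cR d ω R (y, i) else 0))) / piRloc d ω R x

/-- The generator matrix of `Y^R`. -/
def qmatR (d : ℕ) (ω : EnvSp d) (R : ℝ) (x y : Vert d) : ℝ :=
  if x = y then -(∑ z ∈ nbrs d x, rateR d ω R x z) else rateR d ω R x y

/-- Iterates of the generator matrix of `Y^R`. -/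
def qiter (d : ℕ) (ω : EnvSp d) (R : ℝ) : ℕ → Vert d → Vert d → ℝ
  | 0, x, y => if x = y then 1 else 0
  | n+1, x, y => ∑ z ∈ insert x (nbrs d x), qmatR d ω R x z * qiter d ω R n z y

/-- The heat kernel `P_ω^x(Y_t^R = y) = (e^{tQ})(x,y)` of the localized chain `Y^R`. -/
def hkR (d : ℕ) (ω : EnvSp d) (R : ℝ) (t : ℝ) (x y : Vert d) : ℝ :=
  ∑' k : ℕ, t ^ k / (Nat.factorial k : ℝ) * qiter d ω R k x y

/-! ### Finite reversible sub-Markov generators -/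

section FiniteChain

open scoped Matrix.Norms.Operator

variable {ι : Type*} [Fintype ι] [DecidableEq ι]

/-- `Q` is the generator of a (possibly killed) chain on a finite set that is reversible with
respect to `m` and whose holding rates are at most `b`. -/
structure IsRevGen (Q : Matrix ι ι ℝ) (m : ι → ℝ) (b : ℝ) : Prop where
  pos : ∀ x, 0 < m x
  offdiag : ∀ x y, x ≠ y → 0 ≤ Q x y
  symm : ∀ x y, m x * Q x y = m y * Q y x
  rowsum : ∀ x, ∑ y, Q x y ≤ 0
  diag : ∀ x, -b ≤ Q x x

/-- The Dirichlet form of a reversible generator. -/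
def genEnergy (Q : Matrix ι ι ℝ) (m : ι → ℝ) (v : ι → ℝ) : ℝ :=
  -∑ x, ∑ y, m x * Q x y * (v x * v y)

lemma hasSum_exp_smul_apply (Q : Matrix ι ι ℝ) (t : ℝ) (x y : ι) :
    HasSum (fun k : ℕ => t ^ k / (Nat.factorial k : ℝ) * (Q ^ k) x y)
      (NormedSpace.exp (t • Q) x y) := by
  have h := NormedSpace.exp_series_hasSum_exp' (𝕂 := ℝ) (t • Q)
  have h1 : HasSum (fun k : ℕ => (((Nat.factorial k : ℝ)⁻¹ • (t • Q) ^ k : Matrix ι ι ℝ) x y))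
      (NormedSpace.exp (t • Q) x y) := (Pi.hasSum.1 (Pi.hasSum.1 h x)) y
  refine h1.congr_fun fun k => ?_
  rw [smul_pow, Matrix.smul_apply, Matrix.smul_apply, smul_eq_mul, smul_eq_mul]
  ring

lemma hasDerivAt_exp_smul_apply (Q : Matrix ι ι ℝ) (t : ℝ) (x y : ι) :
    HasDerivAt (fun s : ℝ => NormedSpace.exp (s • Q) x y)
      (∑ z, Q x z * NormedSpace.exp (t • Q) z y) t := by
  have h := hasDerivAt_exp_smul_const' (𝕂 := ℝ) Q t
  rw [← Matrix.mul_apply]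
  exact hasDerivAt_pi.1 (hasDerivAt_pi.1 h x) y

lemma hasDerivAt_exp_smul_apply' (Q : Matrix ι ι ℝ) (t : ℝ) (x y : ι) :
    HasDerivAt (fun s : ℝ => NormedSpace.exp (s • Q) x y)
      (∑ z, NormedSpace.exp (t • Q) x z * Q z y) t := by
  have h := hasDerivAt_exp_smul_const (𝕂 := ℝ) Q t
  rw [← Matrix.mul_apply]
  exact hasDerivAt_pi.1 (hasDerivAt_pi.1 h x) y

lemma exp_smul_add_apply (Q : Matrix ι ι ℝ) (s t : ℝ) (x y : ι) :
    NormedSpace.exp ((s + t) • Q) x y =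
      ∑ z, NormedSpace.exp (s • Q) x z * NormedSpace.exp (t • Q) z y := by
  rw [add_smul, Matrix.exp_add_of_commute _ _
    ((Commute.refl Q).smul_left s |>.smul_right t), Matrix.mul_apply]

lemma matrix_pow_nonneg {A : Matrix ι ι ℝ} (hA : ∀ x y, 0 ≤ A x y) (k : ℕ) (x y : ι) :
    0 ≤ (A ^ k) x y := by
  induction k generalizing x y with
  | zero =>
    rw [pow_zero, Matrix.one_apply]
    split_ifs <;> norm_num
  | succ k ih =>
    rw [pow_succ, Matrix.mul_apply]
    exact Finset.sum_nonneg fun z _ => mul_nonneg (ih x z) (hA z y)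

namespace IsRevGen

variable {Q : Matrix ι ι ℝ} {m : ι → ℝ} {b : ℝ}

lemma exp_nonneg (h : IsRevGen Q m b) {t : ℝ} (ht : 0 ≤ t) (x y : ι) :
    0 ≤ NormedSpace.exp (t • Q) x y := by
  have hdec : t • Q = (t • (Q + b • (1 : Matrix ι ι ℝ))) + Matrix.diagonal (fun _ => -(t * b)) := by
    ext i j
    by_cases hij : i = j
    · subst hij
      simp [Matrix.diagonal]
    · simp [Matrix.diagonal, hij]
  have hcomm : Commute (t • (Q + b • (1 : Matrix ι ι ℝ)))
      (Matrix.diagonal (fun _ : ι => -(t * b))) := by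
    have : Matrix.diagonal (fun _ : ι => -(t * b)) = Matrix.scalar ι (-(t * b)) := rfl
    rw [this]
    exact (Matrix.scalar_commute _ (fun r => Commute.all _ _) _).symm
  rw [hdec, Matrix.exp_add_of_commute _ _ hcomm, Matrix.exp_diagonal, Matrix.mul_diagonal]
  refine mul_nonneg ?_ ?_
  · refine (hasSum_exp_smul_apply _ t x y).nonneg fun k => ?_
    refine mul_nonneg (by positivity) (matrix_pow_nonneg (fun i j => ?_) k x y)
    by_cases hij : i = j
    · subst hij
      have := h.diag i
      simp
      linarith
    · simpa [hij] using h.offdiag i j hij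
  · rw [Pi.coe_exp]
    rw [← Real.exp_eq_exp_ℝ]
    positivity

lemma exp_symm (h : IsRevGen Q m b) (t : ℝ) (x y : ι) :
    m x * NormedSpace.exp (t • Q) x y = m y * NormedSpace.exp (t • Q) y x := by
  have hk : ∀ (k : ℕ) (x y : ι), m x * (Q ^ k) x y = m y * (Q ^ k) y x := by
    intro k
    induction k with
    | zero =>
      intro x y
      by_cases hxy : x = y
      · subst hxy; rfl
      · simp [Matrix.one_apply_ne hxy, Matrix.one_apply_ne (Ne.symm hxy)]
    | succ k ih =>
      intro x y
      rw [pow_succ, Matrix.mul_apply, ← pow_succ, pow_succ', Matrix.mul_apply, Finset.mul_sum,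
        Finset.mul_sum]
      refine Finset.sum_congr rfl fun z _ => ?_
      rw [← mul_assoc, ih x z, ← mul_assoc, ← h.symm z y]
      ring
  refine ((hasSum_exp_smul_apply Q t x y).mul_left (m x)).unique ?_
  convert (hasSum_exp_smul_apply Q t y x).mul_left (m y) using 2 with k
  have := hk k x y
  linear_combination (t ^ k / (Nat.factorial k : ℝ)) * this

lemma exp_rowsum_le_one (h : IsRevGen Q m b) {t : ℝ} (ht : 0 ≤ t) (x : ι) :
    ∑ y, NormedSpace.exp (t • Q) x y ≤ 1 := by
  have hd : ∀ s : ℝ, HasDerivAt (fun s : ℝ => ∑ y, NormedSpace.exp (s • Q) x y)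
      (∑ y, ∑ z, NormedSpace.exp (s • Q) x z * Q z y) s := fun s =>
    HasDerivAt.fun_sum fun y _ => hasDerivAt_exp_smul_apply' Q s x y
  have hanti : AntitoneOn (fun s : ℝ => ∑ y, NormedSpace.exp (s • Q) x y) (Set.Ici 0) := by
    refine antitoneOn_of_deriv_nonpos (convex_Ici 0)
      (fun s _ => (hd s).continuousAt.continuousWithinAt)
      (fun s _ => (hd s).differentiableAt.differentiableWithinAt) fun s hs => ?_
    rw [(hd s).deriv, Finset.sum_comm]
    rw [interior_Ici] at hs
    refine Finset.sum_nonpos fun z _ => ?_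
    rw [← Finset.mul_sum]
    exact mul_nonpos_of_nonneg_of_nonpos (h.exp_nonneg (le_of_lt hs) x z) (h.rowsum z)
  refine (hanti (Set.mem_Ici.2 le_rfl) (Set.mem_Ici.2 ht) ht).trans ?_
  simp [Matrix.one_apply]

lemma sum_offdiag_le (h : IsRevGen Q m b) (x : ι) :
    ∑ y ∈ Finset.univ.erase x, Q x y ≤ b := by
  have h1 := h.rowsum x
  rw [← Finset.add_sum_erase _ _ (Finset.mem_univ x)] at h1
  linarith [h.diag x]

/-- The exponentially weighted energy identity, in inequality form. -/
lemma weighted_energy_le (h : IsRevGen Q m b) (φ : ι → ℝ) {Λ : ℝ}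
    (hφ : ∀ x y, x ≠ y → Q x y ≠ 0 → |φ x - φ y| ≤ Λ) (u : ι → ℝ) (hu : ∀ x, 0 ≤ u x) :
    ∑ z, m z * (Real.exp (2 * φ z) * (u z * ∑ w, Q z w * u w)) ≤
      -genEnergy Q m (fun z => Real.exp (φ z) * u z) +
        b * (Real.cosh Λ - 1) * ∑ z, m z * (Real.exp (φ z) * u z) ^ 2 := by
  set v : ι → ℝ := fun z => Real.exp (φ z) * u z with hv
  have hv0 : ∀ x, 0 ≤ v x := fun x => mul_nonneg (Real.exp_pos _).le (hu x)
  have hsym : ∀ x y, m y * Q y x = m x * Q x y := fun x y => (h.symm x y).symm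
  have e1 : ∑ z, m z * (Real.exp (2 * φ z) * (u z * ∑ w, Q z w * u w)) =
      ∑ z, ∑ w, m z * Q z w * (v z * v w) * Real.exp (φ z - φ w) := by
    refine Finset.sum_congr rfl fun z _ => ?_
    rw [Finset.mul_sum, Finset.mul_sum, Finset.mul_sum]
    refine Finset.sum_congr rfl fun w _ => ?_
    have : Real.exp (2 * φ z) = Real.exp (φ z) * Real.exp (φ w) * Real.exp (φ z - φ w) := by
      rw [← Real.exp_add, ← Real.exp_add]; ring_nf
    rw [this]
    simp only [hv]
    ring
  have e2 : ∑ z, ∑ w, m z * Q z w * (v z * v w) * Real.exp (φ z - φ w) =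
      ∑ z, ∑ w, m z * Q z w * (v z * v w) * Real.exp (φ w - φ z) := by
    rw [Finset.sum_comm]
    refine Finset.sum_congr rfl fun z _ => Finset.sum_congr rfl fun w _ => ?_
    rw [hsym]; ring
  have e3 : ∑ z, ∑ w, m z * Q z w * (v z * v w) * Real.exp (φ z - φ w) =
      ∑ z, ∑ w, m z * Q z w * (v z * v w) * Real.cosh (φ z - φ w) := by
    have : ∀ z w, m z * Q z w * (v z * v w) * Real.cosh (φ z - φ w) =
        (m z * Q z w * (v z * v w) * Real.exp (φ z - φ w) +
          m z * Q z w * (v z * v w) * Real.exp (φ w - φ z)) / 2 := by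
      intro z w
      rw [Real.cosh_eq, neg_sub]; ring
    simp_rw [this, ← Finset.sum_div, Finset.sum_add_distrib]
    rw [← e2]; ring
  have hΛ : ∀ z w, z ≠ w → m z * Q z w * (v z * v w) * (Real.cosh (φ z - φ w) - 1) ≤
      (Real.cosh Λ - 1) * (m z * Q z w * (v z * v w)) := by
    intro z w hzw
    by_cases hQ : Q z w = 0
    · simp [hQ]
    have hc : Real.cosh (φ z - φ w) ≤ Real.cosh Λ := by
      rw [Real.cosh_le_cosh]
      exact (hφ z w hzw hQ).trans (le_abs_self _)
    have h0 : 0 ≤ m z * Q z w * (v z * v w) :=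
      mul_nonneg (mul_nonneg (h.pos z).le (h.offdiag z w hzw)) (mul_nonneg (hv0 z) (hv0 w))
    nlinarith
  have hcosh : 0 ≤ Real.cosh Λ - 1 := by linarith [Real.one_le_cosh Λ]
  have e4 : ∑ z, ∑ w, m z * Q z w * (v z * v w) * (Real.cosh (φ z - φ w) - 1) ≤
      (Real.cosh Λ - 1) * ∑ z, ∑ w ∈ Finset.univ.erase z, m z * Q z w * (v z * v w) := by
    rw [Finset.mul_sum]
    refine Finset.sum_le_sum fun z _ => ?_
    rw [← Finset.add_sum_erase _ _ (Finset.mem_univ z), Finset.mul_sum]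
    simp only [sub_self, Real.cosh_zero, mul_zero, zero_add]
    exact Finset.sum_le_sum fun w hw => hΛ z w (Finset.ne_of_mem_erase hw).symm
  have e5 : ∑ z, ∑ w ∈ Finset.univ.erase z, m z * Q z w * (v z * v w) ≤
      b * ∑ z, m z * v z ^ 2 := by
    have hle : ∑ z, ∑ w ∈ Finset.univ.erase z, m z * Q z w * (v z * v w) ≤
        ∑ z, ∑ w ∈ Finset.univ.erase z,
          (m z * Q z w * v z ^ 2 / 2 + m w * Q w z * v w ^ 2 / 2) := by
      refine Finset.sum_le_sum fun z _ => Finset.sum_le_sum fun w hw => ?_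
      have h0 : 0 ≤ m z * Q z w :=
        mul_nonneg (h.pos z).le (h.offdiag z w (Finset.ne_of_mem_erase hw).symm)
      rw [hsym z w]
      nlinarith [sq_nonneg (v z - v w)]
    have hswap : ∑ z, ∑ w ∈ Finset.univ.erase z, m w * Q w z * v w ^ 2 / 2 =
        ∑ z, ∑ w ∈ Finset.univ.erase z, m z * Q z w * v z ^ 2 / 2 := by
      rw [Finset.sum_comm' (t' := Finset.univ) (s' := fun w => Finset.univ.erase w)]
      intro z w
      simp [eq_comm]
    refine hle.trans ?_
    simp_rw [Finset.sum_add_distrib]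
    rw [hswap, ← Finset.sum_add_distrib, Finset.mul_sum]
    refine Finset.sum_le_sum fun z _ => ?_
    rw [← Finset.sum_add_distrib]
    have : ∀ w, m z * Q z w * v z ^ 2 / 2 + m z * Q z w * v z ^ 2 / 2 = m z * v z ^ 2 * Q z w := by
      intro w; ring
    simp_rw [this, ← Finset.mul_sum]
    have h1 := mul_le_mul_of_nonneg_left (h.sum_offdiag_le z)
      (mul_nonneg (h.pos z).le (sq_nonneg (v z)))
    linarith
  have e6 : ∑ z, ∑ w, m z * Q z w * (v z * v w) * Real.cosh (φ z - φ w) =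
      -genEnergy Q m v + ∑ z, ∑ w, m z * Q z w * (v z * v w) * (Real.cosh (φ z - φ w) - 1) := by
    rw [genEnergy, neg_neg, ← Finset.sum_add_distrib]
    refine Finset.sum_congr rfl fun z _ => ?_
    rw [← Finset.sum_add_distrib]
    exact Finset.sum_congr rfl fun w _ => by ring
  rw [e1, e3, e6]
  have := mul_le_mul_of_nonneg_left e5 hcosh
  linarith

end IsRevGen

end FiniteChain

/-! ### Weighted `ℓ²` bounds for heat kernels from a Sobolev inequality -/

section WeightedHeat

variable {ι : Type*}

/-- The function `φ` varies by at most `Λ` along each possible jump of `Q`. -/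
def JumpLip (Q : Matrix ι ι ℝ) (φ : ι → ℝ) (Λ : ℝ) : Prop :=
  ∀ x y, x ≠ y → Q x y ≠ 0 → |φ x - φ y| ≤ Λ

lemma JumpLip.const_mul {Q : Matrix ι ι ℝ} {φ : ι → ℝ} {Λ : ℝ} (h : JumpLip Q φ Λ) {a : ℝ}
    (ha : 0 ≤ a) : JumpLip Q (fun x => a * φ x) (a * Λ) := by
  intro x y hxy hQ
  rw [← mul_sub, abs_mul, abs_of_nonneg ha]
  exact mul_le_mul_of_nonneg_left (h x y hxy hQ) ha

variable [Fintype ι] [DecidableEq ι]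

/-- The heat kernel density with pole `x₀`, relative to `m`. -/
def heatDens (Q : Matrix ι ι ℝ) (m : ι → ℝ) (x₀ : ι) (t : ℝ) (z : ι) : ℝ :=
  NormedSpace.exp (t • Q) z x₀ / m x₀

/-- The squared `ℓ²(m)`-norm of the heat kernel density with weight `exp φ`. -/
def weightedHeat (Q : Matrix ι ι ℝ) (m : ι → ℝ) (x₀ : ι) (φ : ι → ℝ) (t : ℝ) : ℝ :=
  ∑ z, m z * (Real.exp (φ z) * heatDens Q m x₀ t z) ^ 2

/-- The Sobolev inequality `‖v‖_{ℓ^S(m)}² ≤ A (𝓔(v) + η ‖v‖_{ℓ²(m)}²)` for nonnegative `v`. -/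
def SobolevIneq (Q : Matrix ι ι ℝ) (m : ι → ℝ) (S A η : ℝ) : Prop :=
  ∀ v : ι → ℝ, (∀ x, 0 ≤ v x) →
    (∑ x, m x * v x ^ S) ^ (2 / S) ≤ A * (genEnergy Q m v + η * ∑ x, m x * v x ^ 2)

variable {Q : Matrix ι ι ℝ} {m : ι → ℝ} {b : ℝ}

namespace IsRevGen

lemma heatDens_nonneg (h : IsRevGen Q m b) (x₀ : ι) {t : ℝ} (ht : 0 ≤ t) (z : ι) :
    0 ≤ heatDens Q m x₀ t z :=
  div_nonneg (h.exp_nonneg ht z x₀) (h.pos x₀).le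

lemma sum_heatDens_le_one (h : IsRevGen Q m b) (x₀ : ι) {t : ℝ} (ht : 0 ≤ t) :
    ∑ z, m z * heatDens Q m x₀ t z ≤ 1 := by
  refine le_of_eq_of_le (Finset.sum_congr rfl fun z _ => ?_) (h.exp_rowsum_le_one ht x₀)
  have := h.exp_symm t z x₀
  have hp := (h.pos x₀).ne'
  rw [heatDens, mul_div_assoc', this]
  field_simp

lemma weightedHeat_nonneg (h : IsRevGen Q m b) (x₀ : ι) (φ : ι → ℝ) (t : ℝ) :
    0 ≤ weightedHeat Q m x₀ φ t :=
  Finset.sum_nonneg fun z _ => mul_nonneg (h.pos z).le (sq_nonneg _)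

lemma weightedHeat_zero (h : IsRevGen Q m b) {x₀ : ι} {φ : ι → ℝ} (hφ : φ x₀ = 0) :
    weightedHeat Q m x₀ φ 0 = 1 / m x₀ := by
  rw [weightedHeat, Finset.sum_eq_single x₀]
  · have hp := (h.pos x₀).ne'
    simp [heatDens, hφ]
    field_simp
  · intro z _ hz
    simp [heatDens, Matrix.one_apply_ne hz]
  · simp

lemma hasDerivAt_weightedHeat (x₀ : ι) (φ : ι → ℝ) (t : ℝ) :
    HasDerivAt (weightedHeat Q m x₀ φ)
      (2 * ∑ z, m z * (Real.exp (2 * φ z) *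
        (heatDens Q m x₀ t z * ∑ w, Q z w * heatDens Q m x₀ t w))) t := by
  have h1 : ∀ z, HasDerivAt (fun s => heatDens Q m x₀ s z)
      (∑ w, Q z w * heatDens Q m x₀ t w) t := by
    intro z
    refine ((hasDerivAt_exp_smul_apply Q t z x₀).div_const (m x₀)).congr_deriv ?_
    rw [Finset.sum_div]
    exact Finset.sum_congr rfl fun w _ => by rw [heatDens]; ring
  have h2 := HasDerivAt.fun_sum (u := Finset.univ) fun z _ =>
    (((h1 z).const_mul (Real.exp (φ z))).pow 2).const_mul (m z)
  refine h2.congr_deriv ?_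
  rw [Finset.mul_sum]
  refine Finset.sum_congr rfl fun z _ => ?_
  have : Real.exp (2 * φ z) = Real.exp (φ z) * Real.exp (φ z) := by
    rw [← Real.exp_add]; ring_nf
  rw [this]
  push_cast
  ring

lemma deriv_weightedHeat_le (h : IsRevGen Q m b) (x₀ : ι) {φ : ι → ℝ} {Λ : ℝ}
    (hφ : JumpLip Q φ Λ) {t : ℝ} (ht : 0 ≤ t) :
    deriv (weightedHeat Q m x₀ φ) t ≤
      -(2 * genEnergy Q m (fun z => Real.exp (φ z) * heatDens Q m x₀ t z)) +
        2 * b * (Real.cosh Λ - 1) * weightedHeat Q m x₀ φ t := by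
  rw [(hasDerivAt_weightedHeat x₀ φ t).deriv]
  have := h.weighted_energy_le φ hφ _ (h.heatDens_nonneg x₀ ht)
  rw [weightedHeat]
  linarith

lemma genEnergy_nonneg (h : IsRevGen Q m b) (v : ι → ℝ) :
    0 ≤ genEnergy Q m v := by
  have h0 : ∀ x y, m y * Q y x = m x * Q x y := fun x y => (h.symm x y).symm
  have key : ∑ x, ∑ y, m x * Q x y * (v x * v y) ≤
      ∑ x, ∑ y, (m x * Q x y * v x ^ 2 / 2 + m y * Q y x * v y ^ 2 / 2) := by
    refine Finset.sum_le_sum fun x _ => Finset.sum_le_sum fun y _ => ?_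
    rw [h0 x y]
    by_cases hxy : x = y
    · subst hxy
      exact le_of_eq (by ring)
    · nlinarith [mul_nonneg (mul_nonneg (h.pos x).le (h.offdiag x y hxy)) (sq_nonneg (v x - v y))]
  have hsw : ∑ x, ∑ y, m y * Q y x * v y ^ 2 / 2 = ∑ x, ∑ y, m x * Q x y * v x ^ 2 / 2 := by
    rw [Finset.sum_comm]
  have hneg : ∑ x, ∑ y, m x * Q x y * v x ^ 2 / 2 ≤ 0 := by
    refine Finset.sum_nonpos fun x _ => ?_
    have : ∀ y, m x * Q x y * v x ^ 2 / 2 = (m x * v x ^ 2 / 2) * Q x y := fun y => by ring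
    simp_rw [this, ← Finset.mul_sum]
    exact mul_nonpos_of_nonneg_of_nonpos
      (by have := (h.pos x).le; positivity) (h.rowsum x)
  simp_rw [Finset.sum_add_distrib] at key
  rw [genEnergy]
  linarith

/-- Comparison of the weighted norm at two times, given a differential inequality with a
sink term. -/
lemma weightedHeat_sink (x₀ : ι) {φ : ι → ℝ} {β K s t : ℝ} (hst : s ≤ t) (hK : 0 ≤ K)
    (hβ : 0 ≤ β)
    (hd : ∀ τ ∈ Set.Icc s t, deriv (weightedHeat Q m x₀ φ) τ ≤
      -K + β * weightedHeat Q m x₀ φ τ) :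
    weightedHeat Q m x₀ φ t * Real.exp (-(β * t)) + K * Real.exp (-(β * t)) * (t - s) ≤
      weightedHeat Q m x₀ φ s * Real.exp (-(β * s)) := by
  set F := weightedHeat Q m x₀ φ with hF
  have hFd : ∀ τ, HasDerivAt F (deriv F τ) τ := fun τ =>
    (hasDerivAt_weightedHeat (Q := Q) (m := m) x₀ φ τ).differentiableAt.hasDerivAt
  have hG : ∀ τ, HasDerivAt (fun τ => F τ * Real.exp (-(β * τ)) + K * Real.exp (-(β * t)) * τ)
      ((deriv F τ - β * F τ) * Real.exp (-(β * τ)) + K * Real.exp (-(β * t))) τ := by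
    intro τ
    have he : HasDerivAt (fun τ => Real.exp (-(β * τ))) (Real.exp (-(β * τ)) * (-(β * 1))) τ :=
      (((hasDerivAt_id τ).const_mul β).neg).exp
    refine (((hFd τ).mul he).add ((hasDerivAt_id τ).const_mul _)).congr_deriv ?_
    ring
  have hanti : AntitoneOn (fun τ => F τ * Real.exp (-(β * τ)) + K * Real.exp (-(β * t)) * τ)
      (Set.Icc s t) := by
    refine antitoneOn_of_deriv_nonpos (convex_Icc s t)
      (fun τ _ => (hG τ).continuousAt.continuousWithinAt)
      (fun τ _ => (hG τ).differentiableAt.differentiableWithinAt) fun τ hτ => ?_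
    rw [interior_Icc] at hτ
    rw [(hG τ).deriv]
    have h1 := hd τ ⟨hτ.1.le, hτ.2.le⟩
    have h2 : Real.exp (-(β * t)) ≤ Real.exp (-(β * τ)) :=
      Real.exp_le_exp.2 (by nlinarith [hτ.2])
    have h3 := Real.exp_pos (-(β * τ))
    nlinarith
  have := hanti (Set.left_mem_Icc.2 hst) (Set.right_mem_Icc.2 hst) hst
  simp only at this
  linarith

lemma weightedHeat_growth (h : IsRevGen Q m b) (hb : 0 ≤ b) (x₀ : ι) {φ : ι → ℝ} {Λ : ℝ}
    (hφ : JumpLip Q φ Λ) {s t : ℝ} (hs : 0 ≤ s) (hst : s ≤ t) :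
    weightedHeat Q m x₀ φ t ≤
      Real.exp (2 * b * (Real.cosh Λ - 1) * (t - s)) * weightedHeat Q m x₀ φ s := by
  have hβ : 0 ≤ 2 * b * (Real.cosh Λ - 1) :=
    mul_nonneg (by positivity) (by linarith [Real.one_le_cosh Λ])
  have := weightedHeat_sink (Q := Q) (m := m) x₀ (φ := φ) hst le_rfl hβ fun τ hτ => by
    have h1 := h.deriv_weightedHeat_le x₀ hφ (hs.trans hτ.1)
    have h2 := h.genEnergy_nonneg fun z => Real.exp (φ z) * heatDens Q m x₀ τ z
    linarith
  rw [zero_mul, zero_mul, add_zero, Real.exp_neg, ← div_eq_mul_inv,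
    div_le_iff₀ (Real.exp_pos _)] at this
  refine this.trans (le_of_eq ?_)
  rw [mul_assoc, ← Real.exp_add, mul_comm]
  congr 2
  ring

/-- Interpolation between a Sobolev norm with a larger weight and the (unweighted) mass. -/
lemma weightedHeat_rpow_le (h : IsRevGen Q m b) (x₀ : ι) {S : ℝ} (hS : 2 < S) (φ : ι → ℝ) {t : ℝ}
    (ht : 0 ≤ t) :
    weightedHeat Q m x₀ φ t ^ (2 * (S - 1) / S) ≤
      (∑ z, m z * (Real.exp (2 * (S - 1) / S * φ z) * heatDens Q m x₀ t z) ^ S) ^ (2 / S) := by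
  set u := heatDens Q m x₀ t with hu
  have hu0 : ∀ z, 0 ≤ u z := h.heatDens_nonneg x₀ ht
  set a := 2 * (S - 1) / S with ha
  have hS0 : 0 < S := by linarith
  have hS1 : 0 < S - 1 := by linarith
  have hS2 : 0 < S - 2 := by linarith
  have ha0 : 0 < a := by positivity
  have hpq : Real.HolderConjugate (S - 1) ((S - 1) / (S - 2)) := by
    rw [Real.holderConjugate_iff]
    refine ⟨by linarith, ?_⟩
    field_simp
    ring
  set B := ∑ z, m z * (Real.exp (a * φ z) * u z) ^ S with hB
  have hB0 : 0 ≤ B := Finset.sum_nonneg fun z _ => mul_nonneg (h.pos z).le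
    (Real.rpow_nonneg (mul_nonneg (Real.exp_pos _).le (hu0 z)) _)
  have hold := Real.inner_le_Lp_mul_Lq_of_nonneg Finset.univ hpq
    (f := fun z => (m z * (Real.exp (a * φ z) * u z) ^ S) ^ (1 / (S - 1)))
    (g := fun z => (m z * u z) ^ ((S - 2) / (S - 1)))
    (fun z _ => Real.rpow_nonneg (mul_nonneg (h.pos z).le
      (Real.rpow_nonneg (mul_nonneg (Real.exp_pos _).le (hu0 z)) _)) _)
    (fun z _ => Real.rpow_nonneg (mul_nonneg (h.pos z).le (hu0 z)) _)
  have e1 : ∀ z, (m z * (Real.exp (a * φ z) * u z) ^ S) ^ (1 / (S - 1)) *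
      (m z * u z) ^ ((S - 2) / (S - 1)) = m z * (Real.exp (φ z) * u z) ^ 2 := by
    intro z
    have hm := h.pos z
    rcases (hu0 z).eq_or_lt with hz | hz
    · rw [← hz]
      rw [mul_zero, mul_zero, Real.zero_rpow hS0.ne', mul_zero,
        Real.zero_rpow (one_div_pos.2 hS1).ne', zero_mul]
      ring
    · have hexp := Real.exp_pos (a * φ z)
      rw [Real.mul_rpow hm.le (by positivity), ← Real.rpow_mul (by positivity),
        Real.mul_rpow hexp.le hz.le, Real.mul_rpow hm.le hz.le, ← Real.exp_mul]
      have k1 : m z = m z ^ (1 / (S - 1)) * m z ^ ((S - 2) / (S - 1)) := by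
        rw [← Real.rpow_add hm]
        have : 1 / (S - 1) + (S - 2) / (S - 1) = 1 := by field_simp; ring
        rw [this, Real.rpow_one]
      have k2 : u z ^ 2 = u z ^ (S * (1 / (S - 1))) * u z ^ ((S - 2) / (S - 1)) := by
        rw [← Real.rpow_add hz, ← Real.rpow_natCast]
        congr 1
        field_simp
        push_cast
        ring
      have k3 : Real.exp (φ z) ^ 2 = Real.exp (a * φ z * (S * (1 / (S - 1)))) := by
        rw [← Real.exp_nat_mul]
        congr 1
        rw [ha]
        push_cast
        field_simp
      rw [mul_pow, k2, k3]
      nth_rewrite 3 [k1]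
      ring
  have e2 : ∀ z, ((m z * (Real.exp (a * φ z) * u z) ^ S) ^ (1 / (S - 1))) ^ (S - 1) =
      m z * (Real.exp (a * φ z) * u z) ^ S := by
    intro z
    rw [← Real.rpow_mul (mul_nonneg (h.pos z).le
      (Real.rpow_nonneg (mul_nonneg (Real.exp_pos _).le (hu0 z)) _)),
      one_div_mul_cancel hS1.ne', Real.rpow_one]
  have e3 : ∀ z, ((m z * u z) ^ ((S - 2) / (S - 1))) ^ ((S - 1) / (S - 2)) = m z * u z := by
    intro z
    rw [← Real.rpow_mul (mul_nonneg (h.pos z).le (hu0 z))]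
    have : (S - 2) / (S - 1) * ((S - 1) / (S - 2)) = 1 := by field_simp
    rw [this, Real.rpow_one]
  simp_rw [e1, e2, e3] at hold
  have hone : (∑ z, m z * u z) ^ (1 / ((S - 1) / (S - 2))) ≤ 1 :=
    Real.rpow_le_one (Finset.sum_nonneg fun z _ => mul_nonneg (h.pos z).le (hu0 z))
      (h.sum_heatDens_le_one x₀ ht) (by positivity)
  have hle : weightedHeat Q m x₀ φ t ≤ B ^ (1 / (S - 1)) :=
    hold.trans (mul_le_of_le_one_right (Real.rpow_nonneg hB0 _) hone)
  refine (Real.rpow_le_rpow (h.weightedHeat_nonneg x₀ φ t) hle ha0.le).trans (le_of_eq ?_)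
  rw [← Real.rpow_mul hB0]
  congr 1
  rw [ha]
  field_simp

/-- One step of the recursion: the weight `φ` at time `t` is controlled by the weight
`(2 (S - 1) / S) φ` at time `t / 2`. -/
lemma weightedHeat_step (h : IsRevGen Q m b) (hb : 0 ≤ b) (x₀ : ι) {S A η : ℝ} (hS : 2 < S)
    (hA : 0 < A) (hη : 0 ≤ η) (hSob : SobolevIneq Q m S A η) {φ : ι → ℝ} {Λ : ℝ}
    (hφ : JumpLip Q φ Λ) {t : ℝ} (ht : 0 < t) :
    weightedHeat Q m x₀ φ t ^ (2 * (S - 1) / S) ≤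
      A / t * Real.exp ((b * (Real.cosh (2 * (S - 1) / S * Λ) - 1) + η +
          2 * (S - 1) / S * (b * (Real.cosh Λ - 1))) * t) *
        weightedHeat Q m x₀ (fun z => 2 * (S - 1) / S * φ z) (t / 2) := by
  set a := 2 * (S - 1) / S with ha
  have ha0 : 0 < a := div_pos (by linarith) (by linarith)
  have hc1 : 0 ≤ b * (Real.cosh Λ - 1) := mul_nonneg hb (by linarith [Real.one_le_cosh Λ])
  have hc2 : 0 ≤ b * (Real.cosh (a * Λ) - 1) :=
    mul_nonneg hb (by linarith [Real.one_le_cosh (a * Λ)])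
  set X := weightedHeat Q m x₀ φ t with hX
  have hX0 : 0 ≤ X := h.weightedHeat_nonneg x₀ φ t
  set β := 2 * b * (Real.cosh (a * Λ) - 1) + 2 * η with hβ
  set K := 2 / A * (Real.exp (-(b * (Real.cosh Λ - 1) * t)) * X) ^ a with hK
  have hK0 : 0 ≤ K := mul_nonneg (by positivity)
    (Real.rpow_nonneg (mul_nonneg (Real.exp_pos _).le hX0) _)
  have hs := weightedHeat_sink (Q := Q) (m := m) x₀ (φ := fun z => a * φ z) (s := t / 2) (t := t)
    (β := β) (by linarith) hK0 (by linarith) fun τ hτ => by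
      have hτ0 : 0 ≤ τ := by linarith [hτ.1]
      have h1 := h.deriv_weightedHeat_le x₀ (hφ.const_mul ha0.le) hτ0
      have h2 := (h.weightedHeat_rpow_le x₀ hS φ hτ0).trans
        (hSob (fun z => Real.exp (a * φ z) * heatDens Q m x₀ τ z)
        fun z => mul_nonneg (Real.exp_pos _).le (h.heatDens_nonneg x₀ hτ0 z))
      have h3 : Real.exp (-(b * (Real.cosh Λ - 1) * t)) * X ≤ weightedHeat Q m x₀ φ τ := by
        have := h.weightedHeat_growth hb x₀ hφ hτ0 hτ.2
        rw [Real.exp_neg, inv_mul_le_iff₀ (Real.exp_pos _)]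
        refine this.trans (mul_le_mul_of_nonneg_right (Real.exp_le_exp.2 ?_)
          (h.weightedHeat_nonneg x₀ φ τ))
        nlinarith [hτ.1]
      have h4 := (Real.rpow_le_rpow (mul_nonneg (Real.exp_pos _).le hX0) h3 ha0.le).trans h2
      have h5 : K ≤ 2 * (genEnergy Q m (fun z => Real.exp (a * φ z) * heatDens Q m x₀ τ z) +
          η * weightedHeat Q m x₀ (fun z => a * φ z) τ) := by
        rw [hK, div_mul_eq_mul_div, div_le_iff₀ hA]
        unfold weightedHeat
        linarith
      rw [hβ]
      linarith
  have h6 : K * Real.exp (-(β * t)) * (t - t / 2) ≤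
      weightedHeat Q m x₀ (fun z => a * φ z) (t / 2) * Real.exp (-(β * (t / 2))) := by
    have := mul_nonneg (h.weightedHeat_nonneg x₀ (fun z => a * φ z) t)
      (Real.exp_pos (-(β * t))).le
    linarith
  have h7 : K = 2 / A * (Real.exp (-(a * (b * (Real.cosh Λ - 1)) * t)) * X ^ a) := by
    rw [hK, Real.mul_rpow (Real.exp_pos _).le hX0, ← Real.exp_mul]
    congr 3
    ring
  rw [h7] at h6
  set W := weightedHeat Q m x₀ (fun z => a * φ z) (t / 2) with hW
  have h8 : X ^ a = (A / t * Real.exp (a * (b * (Real.cosh Λ - 1)) * t) * Real.exp (β * t)) *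
      (2 / A * (Real.exp (-(a * (b * (Real.cosh Λ - 1)) * t)) * X ^ a) *
        Real.exp (-(β * t)) * (t - t / 2)) := by
    rw [Real.exp_neg, Real.exp_neg]
    have := Real.exp_pos (a * (b * (Real.cosh Λ - 1)) * t)
    have := Real.exp_pos (β * t)
    field_simp
    ring
  rw [h8]
  refine (mul_le_mul_of_nonneg_left h6 (by positivity)).trans (le_of_eq ?_)
  have h9 : Real.exp ((b * (Real.cosh (a * Λ) - 1) + η + a * (b * (Real.cosh Λ - 1))) * t) =
      Real.exp (a * (b * (Real.cosh Λ - 1)) * t) * Real.exp (β * t) *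
        Real.exp (-(β * (t / 2))) := by
    rw [← Real.exp_add, ← Real.exp_add]
    congr 1
    rw [hβ]
    ring
  rw [h9]
  ring

end IsRevGen

end WeightedHeat

section WeightedHeatIteration

variable {ι : Type*} [Fintype ι] [DecidableEq ι] {Q : Matrix ι ι ℝ} {m : ι → ℝ} {b : ℝ}

lemma cosh_sub_one_le_mul_exp (x : ℝ) : Real.cosh x - 1 ≤ x ^ 2 / 2 * Real.exp (x ^ 2 / 2) := by
  have h1 := Real.cosh_le_exp_half_sq x
  have h2 := Real.add_one_le_exp (-(x ^ 2 / 2))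
  have h3 := Real.exp_pos (x ^ 2 / 2)
  have h4 : Real.exp (x ^ 2 / 2) * Real.exp (-(x ^ 2 / 2)) = 1 := by
    rw [← Real.exp_add, add_neg_cancel, Real.exp_zero]
  nlinarith

lemma cosh_sub_one_le_of_abs_le_two {x : ℝ} (hx : |x| ≤ 2) : Real.cosh x - 1 ≤ 8 * x ^ 2 := by
  have hsq : x ^ 2 ≤ 4 := by nlinarith [sq_abs x, abs_nonneg x]
  have h1 : Real.exp (x ^ 2 / 2) ≤ Real.exp 2 := Real.exp_le_exp.2 (by linarith)
  have h2 : Real.exp 2 ≤ 16 := by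
    have : Real.exp 2 = Real.exp 1 ^ 2 := by rw [← Real.exp_nat_mul]; norm_num
    rw [this]
    nlinarith [Real.exp_one_lt_three, Real.exp_pos 1]
  have h3 := cosh_sub_one_le_mul_exp x
  nlinarith [sq_nonneg x]

namespace IsRevGen

/-- Iterating `weightedHeat_step` `k` times for moderate weights. -/
lemma weightedHeat_iterate (h : IsRevGen Q m b) (hb : 0 ≤ b) (x₀ : ι) {S A η : ℝ} (hS : 2 < S)
    (hA : 0 < A) (hη : 0 ≤ η) (hSob : SobolevIneq Q m S A η) (k : ℕ) {φ : ι → ℝ} {Λ : ℝ}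
    (hφ : JumpLip Q φ Λ) (hφ0 : φ x₀ = 0) (hΛ : 0 ≤ Λ)
    (hk : (2 * (S - 1) / S) ^ k * Λ ≤ 2) {t : ℝ} (ht : 0 < t) (htη : η * t ≤ 1) :
    weightedHeat Q m x₀ φ t ≤
      (Real.exp 1 * 2 ^ (S / (S - 2)) * A / t) ^
          (S / (S - 2) * (1 - (S / (2 * (S - 1))) ^ k)) *
        Real.exp (48 * b * S * t * Λ ^ 2) * (1 / m x₀) ^ (((S / (2 * (S - 1))) ^ k : ℝ)) := by
  have hS0 : 0 < S := by linarith
  have hS1 : 0 < S - 1 := by linarith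
  have hS2 : 0 < S - 2 := by linarith
  set a := 2 * (S - 1) / S with ha
  set θ := S / (2 * (S - 1)) with hθ
  set γ := S / (S - 2) with hγ
  have ha1 : 1 < a := by rw [ha, lt_div_iff₀ hS0]; linarith
  have ha2 : a < 2 := by rw [ha, div_lt_iff₀ hS0]; linarith
  have ha0 : 0 < a := by linarith
  have hθ0 : 0 < θ := by positivity
  have haθ : a * θ = 1 := by rw [ha, hθ]; field_simp
  have hθ1 : θ < 1 := by nlinarith
  have hγ0 : 0 < γ := by positivity
  have hγθ : γ * (1 - θ) = θ := by rw [hγ, hθ]; field_simp; ring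
  have hm := h.pos x₀
  have hcosh : ∀ x : ℝ, 0 ≤ Real.cosh x - 1 := fun x => by linarith [Real.one_le_cosh x]
  induction k generalizing φ Λ t with
  | zero =>
    have hg := h.weightedHeat_growth hb x₀ hφ le_rfl ht.le
    rw [h.weightedHeat_zero hφ0] at hg
    rw [pow_zero, one_mul] at hk
    have hc := cosh_sub_one_le_of_abs_le_two (x := Λ) (by rwa [abs_of_nonneg hΛ])
    simp only [pow_zero, sub_self, mul_zero, Real.rpow_zero, one_mul, Real.rpow_one]
    refine hg.trans (mul_le_mul_of_nonneg_right (Real.exp_le_exp.2 ?_) (by positivity))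
    rw [sub_zero]
    have h1 : 2 * b * (Real.cosh Λ - 1) * t ≤ 2 * b * (8 * Λ ^ 2) * t := by gcongr
    have h2 : 0 ≤ b * t * Λ ^ 2 := by positivity
    nlinarith
  | succ k ih =>
    have hak : a * Λ ≤ 2 := by
      refine le_trans ?_ hk
      rw [pow_succ, mul_assoc]
      exact le_mul_of_one_le_left (by positivity) (one_le_pow₀ ha1.le)
    have hIH := ih (φ := fun z => a * φ z) (Λ := a * Λ) (t := t / 2) (hφ.const_mul ha0.le)
      (by simp [hφ0]) (by positivity) (by positivity) (by nlinarith)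
      (by rwa [← mul_assoc, ← pow_succ])
    have hstep := h.weightedHeat_step hb x₀ hS hA hη hSob hφ ht
    rw [← ha] at hstep
    have hexp : Real.exp ((b * (Real.cosh (a * Λ) - 1) + η + a * (b * (Real.cosh Λ - 1))) * t) ≤
        Real.exp 1 * Real.exp (48 * b * t * Λ ^ 2) := by
      rw [← Real.exp_add]
      refine Real.exp_le_exp.2 ?_
      have c1 := cosh_sub_one_le_of_abs_le_two (x := a * Λ)
        (by rwa [abs_of_nonneg (by positivity)])
      have c2 := cosh_sub_one_le_of_abs_le_two (x := Λ)
        (by rw [abs_of_nonneg hΛ]; nlinarith)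
      have d1 : b * (Real.cosh (a * Λ) - 1) ≤ b * (32 * Λ ^ 2) := by
        gcongr
        have : a ^ 2 ≤ 4 := by nlinarith
        nlinarith [sq_nonneg Λ]
      have d2 : a * (b * (Real.cosh Λ - 1)) ≤ 2 * (b * (8 * Λ ^ 2)) :=
        mul_le_mul ha2.le (mul_le_mul_of_nonneg_left c2 hb) (mul_nonneg hb (hcosh _)) (by norm_num)
      nlinarith
    set C := Real.exp 1 * 2 ^ γ * A / t with hC
    have hC0 : 0 < C := by positivity
    set μ := 1 / m x₀ with hμ
    have hμ0 : 0 < μ := by positivity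
    have hX0 := h.weightedHeat_nonneg x₀ φ t
    have hbig : weightedHeat Q m x₀ φ t ^ a ≤
        A / t * (Real.exp 1 * Real.exp (48 * b * t * Λ ^ 2)) *
          ((2 * C) ^ (γ * (1 - θ ^ k)) * Real.exp (48 * b * S * (t / 2) * (a * Λ) ^ 2) *
            μ ^ ((θ ^ k : ℝ))) := by
      have e : Real.exp 1 * 2 ^ γ * A / (t / 2) = 2 * C := by rw [hC]; field_simp
      rw [e] at hIH
      refine hstep.trans ?_
      have hW0 := h.weightedHeat_nonneg x₀ (fun z => a * φ z) (t / 2)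
      gcongr
    have hfin := Real.rpow_le_rpow (Real.rpow_nonneg hX0 _) hbig hθ0.le
    rw [← Real.rpow_mul hX0, haθ, Real.rpow_one] at hfin
    refine hfin.trans ?_
    have hk1 : 0 ≤ 1 - θ ^ k := by linarith [pow_le_one₀ (n := k) hθ0.le hθ1.le]
    have hkle : 1 - θ ^ k ≤ 1 := by linarith [pow_pos hθ0 k]
    rw [Real.mul_rpow (by positivity) (by positivity),
      Real.mul_rpow (by positivity) (by positivity),
      Real.mul_rpow (by positivity) (by positivity), Real.mul_rpow (by positivity) (by positivity),
      Real.mul_rpow (by positivity) (by positivity), ← Real.rpow_mul (by positivity),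
      ← Real.rpow_mul hμ0.le, ← pow_succ, ← Real.exp_mul (48 * b * t * Λ ^ 2),
      ← Real.exp_mul (48 * b * S * (t / 2) * (a * Λ) ^ 2),
      Real.mul_rpow (by positivity : (0:ℝ) ≤ 2) hC0.le]
    have e1 : γ * (1 - θ ^ (k + 1)) = θ + γ * (1 - θ ^ k) * θ := by
      rw [pow_succ]; linear_combination hγθ
    have e2 : C ^ (γ * (1 - θ ^ (k + 1))) = C ^ θ * C ^ (γ * (1 - θ ^ k) * θ) := by
      rw [e1, Real.rpow_add hC0]
    have e3 : (A / t) ^ θ * Real.exp 1 ^ θ * 2 ^ (γ * (1 - θ ^ k) * θ) ≤ C ^ θ := by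
      have : C ^ θ = (A / t) ^ θ * Real.exp 1 ^ θ * 2 ^ (γ * θ) := by
        rw [Real.rpow_mul (by norm_num), ← Real.mul_rpow (by positivity) (by positivity),
          ← Real.mul_rpow (by positivity) (by positivity), hC]
        congr 1
        ring
      rw [this]
      gcongr
      · norm_num
      · exact mul_le_of_le_one_right hγ0.le hkle
    have e4 : Real.exp (48 * b * t * Λ ^ 2 * θ) *
        Real.exp (48 * b * S * (t / 2) * (a * Λ) ^ 2 * θ) ≤ Real.exp (48 * b * S * t * Λ ^ 2) := by
      rw [← Real.exp_add]
      refine Real.exp_le_exp.2 ?_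
      have k1 : 48 * b * t * Λ ^ 2 * θ + 48 * b * S * (t / 2) * (a * Λ) ^ 2 * θ =
          48 * b * t * Λ ^ 2 * (θ + S / 2 * a) := by
        linear_combination 48 * b * S * (t / 2) * a * Λ ^ 2 * haθ
      have k2 : S / 2 * a = S - 1 := by rw [ha]; field_simp
      rw [k1, k2]
      have : 48 * b * t * Λ ^ 2 * (θ + (S - 1)) ≤ 48 * b * t * Λ ^ 2 * S := by
        gcongr
        linarith
      linarith
    rw [e2]
    calc _ = ((A / t) ^ θ * Real.exp 1 ^ θ * 2 ^ (γ * (1 - θ ^ k) * θ)) *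
            C ^ (γ * (1 - θ ^ k) * θ) * (Real.exp (48 * b * t * Λ ^ 2 * θ) *
            Real.exp (48 * b * S * (t / 2) * (a * Λ) ^ 2 * θ)) * μ ^ (θ ^ (k + 1)) := by ring
      _ ≤ _ := by gcongr

end IsRevGen

end WeightedHeatIteration

section DiscreteSobolev

variable {d : ℕ}

lemma pi_count_eq_count (d : ℕ) :
    Measure.pi (fun _ : Fin d => (Measure.count : Measure ℤ)) = Measure.count := by
  refine Measure.ext_of_singleton fun x => ?_
  simp [Measure.pi_singleton]

/-- The discrete Gagliardo–Nirenberg–Sobolev grid-lines inequality on `ℤ^d`. -/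
lemma tsum_prod_tsum_update_rpow_le (hd : 2 ≤ d) (f : Vert d → ℝ≥0∞) :
    ∑' x : Vert d, ∏ i, (∑' n : ℤ, f (Function.update x i n)) ^ ((1 : ℝ) / ((d : ℝ) - 1)) ≤
      (∑' x, f x) ^ ((d : ℝ) / ((d : ℝ) - 1)) := by
  have hd' : (2 : ℝ) ≤ d := by exact_mod_cast hd
  have hp : Real.HolderConjugate (Fintype.card (Fin d) : ℝ) ((d : ℝ) / ((d : ℝ) - 1)) := by
    rw [Fintype.card_fin]
    exact Real.HolderConjugate.conjExponent (by linarith)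
  have := lintegral_prod_lintegral_pow_le (fun _ : Fin d => (Measure.count : Measure ℤ)) hp
    (f := f) Measurable.of_discrete
  rw [pi_count_eq_count] at this
  simpa only [lintegral_count, Fintype.card_fin] using this

lemma enorm_le_tsum_enorm_sub {f : ℤ → ℝ} (N : ℤ) (hN : ∀ n, N ≤ n → f n = 0) (n : ℤ) :
    ‖f n‖ₑ ≤ ∑' k : ℤ, ‖f (k + 1) - f k‖ₑ := by
  have key : ∀ j : ℕ, ∀ n : ℤ, f (n + j) = 0 →
      ‖f n‖ₑ ≤ ∑ k ∈ Finset.range j, ‖f (n + k + 1) - f (n + k)‖ₑ := by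
    intro j
    induction j with
    | zero => intro n h; simp at h; simp [h]
    | succ j ih =>
      intro n h
      have h1 := ih (n + 1) (by rw [← h]; congr 1; push_cast; ring)
      rw [Finset.sum_range_succ']
      have h2 : ‖f n‖ₑ ≤ ‖f (n + 1)‖ₑ + ‖f (n + 1) - f n‖ₑ := by
        calc ‖f n‖ₑ = ‖f (n + 1) - (f (n + 1) - f n)‖ₑ := by congr 1; ring
          _ ≤ _ := enorm_sub_le
      refine h2.trans ?_
      simp only [Nat.cast_zero, add_zero]
      gcongr
      refine h1.trans (le_of_eq (Finset.sum_congr rfl fun k _ => ?_))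
      push_cast
      rw [show n + 1 + (k : ℤ) = n + (k + 1) by ring]
  refine (key (N - n).toNat n (hN _ ?_)).trans ?_
  · have := Int.self_le_toNat (N - n); omega
  · have hinj : Function.Injective fun k : ℕ => n + (k : ℤ) := fun a b h => by simpa using h
    exact (ENNReal.sum_le_tsum _).trans
      (ENNReal.tsum_comp_le_tsum_of_injective hinj fun k : ℤ => ‖f (k + 1) - f k‖ₑ)

lemma update_add_unitv (x : Vert d) (i : Fin d) (n : ℤ) :
    Function.update x i n + unitv d i = Function.update x i (n + 1) := by
  ext j
  by_cases hj : j = i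
  · subst hj; simp [unitv]
  · simp [unitv, hj]

/-- The increment of `f` along the edge `e`. -/
def edgeGrad (f : Vert d → ℝ) (e : EdgeIx d) : ℝ := f (e.1 + unitv d e.2) - f e.1

lemma mem_edgesIn {B : Finset (Vert d)} {e : EdgeIx d} :
    e ∈ edgesIn d B ↔ e.1 ∈ B ∨ e.1 + unitv d e.2 ∈ B := by
  obtain ⟨x, i⟩ := e
  simp only [edgesIn, Finset.mem_biUnion, Finset.mem_union, Finset.mem_image, Finset.mem_univ,
    true_and, Prod.mk.injEq]
  constructor
  · rintro ⟨y, hy, ⟨j, rfl, rfl⟩ | ⟨j, rfl, rfl⟩⟩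
    · exact Or.inl hy
    · right; simpa using hy
  · rintro (h | h)
    · exact ⟨x, h, Or.inl ⟨i, rfl, rfl⟩⟩
    · exact ⟨_, h, Or.inr ⟨i, by simp, rfl⟩⟩

lemma edgesIn_mono {B C : Finset (Vert d)} (h : B ⊆ C) : edgesIn d B ⊆ edgesIn d C := by
  intro e he
  rw [mem_edgesIn] at he ⊢
  exact he.imp (fun a => h a) fun a => h a

lemma edgeGrad_eq_zero {B : Finset (Vert d)} {f : Vert d → ℝ} (hf : ∀ x ∉ B, f x = 0)
    {e : EdgeIx d} (he : e ∉ edgesIn d B) : edgeGrad f e = 0 := by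
  rw [mem_edgesIn, not_or] at he
  simp [edgeGrad, hf _ he.1, hf _ he.2]

lemma sum_edgesIn_eq_sum_fst {B : Finset (Vert d)} {F : EdgeIx d → ℝ}
    (hF : ∀ e, e.1 ∉ B → F e = 0) : ∑ e ∈ edgesIn d B, F e = ∑ x ∈ B, ∑ i, F (x, i) := by
  rw [← Finset.sum_subset (s₁ := B ×ˢ (Finset.univ : Finset (Fin d)))]
  · rw [Finset.sum_product]
  · intro e he; rw [mem_edgesIn]; simp at he; exact Or.inl he
  · intro e _ he; simp at he; exact hF _ he

lemma sum_edgesIn_eq_sum_snd {B : Finset (Vert d)} {F : EdgeIx d → ℝ}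
    (hF : ∀ e, e.1 + unitv d e.2 ∉ B → F e = 0) :
    ∑ e ∈ edgesIn d B, F e = ∑ x ∈ B, ∑ i, F (x - unitv d i, i) := by
  rw [← Finset.sum_subset
    (s₁ := (B ×ˢ (Finset.univ : Finset (Fin d))).image fun e => (e.1 - unitv d e.2, e.2))]
  · rw [Finset.sum_image, Finset.sum_product]
    rintro ⟨x, i⟩ _ ⟨y, j⟩ _ h
    simp only [Prod.mk.injEq] at h
    obtain ⟨h, rfl⟩ := h
    simpa using h
  · intro e he
    rw [mem_edgesIn]
    simp only [Finset.mem_image, Finset.mem_product, Finset.mem_univ, and_true] at he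
    obtain ⟨a, ha, rfl⟩ := he
    right; simpa using ha
  · intro e _ he
    refine hF _ fun hB => he ?_
    simp only [Finset.mem_image, Finset.mem_product, Finset.mem_univ, and_true]
    exact ⟨(e.1 + unitv d e.2, e.2), hB, by simp⟩

lemma sum_edgesIn_fst_add_snd (B : Finset (Vert d)) (f : Vert d → ℝ) (hf : ∀ x ∉ B, f x = 0) :
    ∑ e ∈ edgesIn d B, (f e.1 + f (e.1 + unitv d e.2)) = 2 * d * ∑ x ∈ B, f x := by
  rw [Finset.sum_add_distrib, sum_edgesIn_eq_sum_fst fun e he => hf _ he,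
    sum_edgesIn_eq_sum_snd (F := fun e => f (e.1 + unitv d e.2)) fun e he => hf _ he]
  simp only [sub_add_cancel, Finset.sum_const, Finset.card_univ, Fintype.card_fin, nsmul_eq_mul,
    ← Finset.mul_sum]
  ring

lemma tsum_enorm_edgeGrad {B : Finset (Vert d)} {g : Vert d → ℝ} (hg : ∀ x ∉ B, g x = 0) :
    ∑' x : Vert d, ∑ i, ‖edgeGrad g (x, i)‖ₑ =
      ENNReal.ofReal (∑ e ∈ edgesIn d B, |edgeGrad g e|) := by
  rw [ENNReal.ofReal_sum_of_nonneg fun _ _ => abs_nonneg _]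
  have : ∑' x : Vert d, ∑ i, ‖edgeGrad g (x, i)‖ₑ = ∑' e : EdgeIx d, ‖edgeGrad g e‖ₑ := by
    rw [ENNReal.tsum_prod']
    exact tsum_congr fun x => (tsum_fintype _).symm
  rw [this, tsum_eq_sum (s := edgesIn d B)]
  · exact Finset.sum_congr rfl fun e _ => Real.enorm_eq_ofReal_abs _
  · intro e he
    simp [edgeGrad_eq_zero hg he]

/-- The discrete Gagliardo–Nirenberg–Sobolev inequality on `ℤ^d`. -/
theorem sum_rpow_le_sum_abs_edgeGrad_rpow (hd : 2 ≤ d) (B : Finset (Vert d)) (g : Vert d → ℝ)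
    (hg : ∀ x ∉ B, g x = 0) :
    ∑ x ∈ B, |g x| ^ ((d : ℝ) / ((d : ℝ) - 1)) ≤
      (∑ e ∈ edgesIn d B, |edgeGrad g e|) ^ ((d : ℝ) / ((d : ℝ) - 1)) := by
  have hd' : (2 : ℝ) ≤ d := by exact_mod_cast hd
  have hp0 : 0 < (d : ℝ) / ((d : ℝ) - 1) := div_pos (by linarith) (by linarith)
  have hsum0 : 0 ≤ ∑ e ∈ edgesIn d B, |edgeGrad g e| := Finset.sum_nonneg fun _ _ => abs_nonneg _
  set f : Vert d → ℝ≥0∞ := fun x => ∑ i, ‖edgeGrad g (x, i)‖ₑ with hf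
  have hpt : ∀ x : Vert d, ‖g x‖ₑ ^ ((d : ℝ) / ((d : ℝ) - 1)) ≤
      ∏ i, (∑' n : ℤ, f (Function.update x i n)) ^ ((1 : ℝ) / ((d : ℝ) - 1)) := by
    intro x
    have e1 : ‖g x‖ₑ ^ ((d : ℝ) / ((d : ℝ) - 1)) =
        ∏ _i : Fin d, ‖g x‖ₑ ^ ((1 : ℝ) / ((d : ℝ) - 1)) := by
      rw [Finset.prod_const, Finset.card_univ, Fintype.card_fin, ← ENNReal.rpow_natCast,
        ← ENNReal.rpow_mul]
      congr 1; ring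
    rw [e1]
    refine Finset.prod_le_prod' fun i _ => ?_
    refine ENNReal.rpow_le_rpow ?_ (div_nonneg zero_le_one (by linarith))
    obtain ⟨N, hN⟩ : ∃ N : ℤ, ∀ y ∈ B, y i < N := by
      obtain ⟨M, hM⟩ := (B.image fun y => y i).bddAbove
      exact ⟨M + 1, fun y hy => Int.lt_add_one_of_le
        (hM (Finset.mem_coe.2 (Finset.mem_image_of_mem _ hy)))⟩
    have h1 := enorm_le_tsum_enorm_sub (f := fun n => g (Function.update x i n)) N
      (fun n hn => hg _ fun hB => by have := hN _ hB; simp at this; omega) (x i)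
    simp only [Function.update_eq_self] at h1
    refine h1.trans (ENNReal.tsum_le_tsum fun n => ?_)
    rw [← update_add_unitv]
    exact Finset.single_le_sum (f := fun j => ‖edgeGrad g (Function.update x i n, j)‖ₑ)
      (fun _ _ => zero_le) (Finset.mem_univ i)
  have hmain := (ENNReal.tsum_le_tsum hpt).trans (tsum_prod_tsum_update_rpow_le hd f)
  rw [tsum_enorm_edgeGrad hg, ENNReal.ofReal_rpow_of_nonneg hsum0 hp0.le] at hmain
  have h2 := (ENNReal.sum_le_tsum B).trans hmain
  have e2 : ∀ x, ‖g x‖ₑ ^ ((d : ℝ) / ((d : ℝ) - 1)) =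
      ENNReal.ofReal (|g x| ^ ((d : ℝ) / ((d : ℝ) - 1))) := fun x => by
    rw [Real.enorm_eq_ofReal_abs, ENNReal.ofReal_rpow_of_nonneg (abs_nonneg _) hp0.le]
  rw [Finset.sum_congr rfl fun x _ => e2 x,
    ← ENNReal.ofReal_sum_of_nonneg fun _ _ => by positivity] at h2
  exact (ENNReal.ofReal_le_ofReal_iff (by positivity)).1 h2

end DiscreteSobolev

section WeightedSobolev

variable {d : ℕ}

lemma abs_rpow_sub_rpow_le {a b α : ℝ} (ha : 0 ≤ a) (hb : 0 ≤ b) (hα : 1 ≤ α) :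
    |a ^ α - b ^ α| ≤ α * |a - b| * (a ^ (α - 1) + b ^ (α - 1)) := by
  wlog hab : b ≤ a generalizing a b
  · have := this hb ha (le_of_not_ge hab)
    rwa [abs_sub_comm, abs_sub_comm a b, add_comm (a ^ (α - 1))]
  rcases ha.eq_or_lt with rfl | ha0
  · have : b = 0 := le_antisymm hab hb
    subst this
    simp
  have h1 := one_add_mul_self_le_rpow_one_add (s := b / a - 1)
    (by linarith [div_nonneg hb ha]) hα
  rw [add_sub_cancel, Real.div_rpow hb ha, le_div_iff₀ (by positivity)] at h1
  have h2 : a ^ α = a ^ (α - 1) * a := by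
    rw [← Real.rpow_add_one ha0.ne']; congr 1; ring
  have h3 : (1 + α * (b / a - 1)) * a ^ α = a ^ α - α * (a - b) * a ^ (α - 1) := by
    rw [h2]; field_simp; ring
  have h4 : b ^ α ≤ a ^ α := Real.rpow_le_rpow hb hab (by linarith)
  rw [abs_of_nonneg (by linarith), abs_of_nonneg (by linarith)]
  have h5 : 0 ≤ α * (a - b) * b ^ (α - 1) := by
    have : 0 ≤ a - b := by linarith
    positivity
  nlinarith

lemma add_rpow_le_two_rpow_mul {a b r : ℝ} (ha : 0 ≤ a) (hb : 0 ≤ b) (hr : 1 ≤ r) :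
    (a + b) ^ r ≤ 2 ^ (r - 1) * (a ^ r + b ^ r) := by
  have := NNReal.rpow_add_le_mul_rpow_add_rpow ⟨a, ha⟩ ⟨b, hb⟩ hr
  exact_mod_cast this

/-- A weighted Sobolev inequality on `ℤ^d`: the inverse conductances enter through their
`ℓ^q`-norm near the support. -/
theorem exists_sum_rpow_le_energy (hd : 2 ≤ d) {q : ℝ} (hq : 1 < q) :
    ∃ C : ℝ, 0 < C ∧ ∀ c : EdgeIx d → ℝ, (∀ e, 0 < c e) → ∀ (G : Finset (Vert d)) (w : Vert d → ℝ),
      (∀ x, 0 ≤ w x) → (∀ x ∉ G, w x = 0) →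
      (∑ x ∈ G, w x ^ (2 * q * d / (q * (d - 2) + d))) ^ (2 / (2 * q * d / (q * (d - 2) + d))) ≤
        C * (∑ e ∈ edgesIn d G, c e ^ (-q)) ^ (1 / q) *
          ∑ e ∈ edgesIn d G, c e * edgeGrad w e ^ 2 := by
  have hd' : (2 : ℝ) ≤ d := by exact_mod_cast hd
  have hq0 : 0 < q := by linarith
  have hq1 : 0 < q - 1 := by linarith
  have hd1 : 0 < (d : ℝ) - 1 := by linarith
  have hd0 : 0 < (d : ℝ) := by linarith
  have hden : 0 < q * (d - 2) + d := by nlinarith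
  set ρ := 2 * q * d / (q * (d - 2) + d) with hρ
  set α := 2 * q * (d - 1) / (q * (d - 2) + d) with hα
  set q' := q / (q - 1) with hq'
  have hρ0 : 0 < ρ := by positivity
  have hα1 : 1 < α := by rw [hα, lt_div_iff₀ hden]; nlinarith
  have hqq : q.HolderConjugate q' := Real.HolderConjugate.conjExponent hq
  have hq'1 : 1 < q' := by rw [hq', lt_div_iff₀ hq1]; linarith
  have hαρ : α * (d / (d - 1)) = ρ := by rw [hα, hρ]; field_simp
  have hαρ' : (α - 1) * 2 * q' = ρ := by rw [hα, hρ, hq']; field_simp; ring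
  have hexp : (d - 1) / d * 2 = 2 / ρ + 1 / q' := by rw [hρ, hq']; field_simp; ring
  refine ⟨2 * α ^ 2 * (2 ^ (q' - 1) * (2 * d)) ^ (1 / q'), by positivity, ?_⟩
  intro c hc G w hw hwG
  set W := ∑ x ∈ G, w x ^ ρ with hW
  set K := ∑ e ∈ edgesIn d G, c e ^ (-q) with hK
  set D := ∑ e ∈ edgesIn d G, c e * edgeGrad w e ^ 2 with hD
  have hW0 : 0 ≤ W := Finset.sum_nonneg fun x _ => Real.rpow_nonneg (hw x) _
  have hK0 : 0 ≤ K := Finset.sum_nonneg fun e _ => Real.rpow_nonneg (hc e).le _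
  have hD0 : 0 ≤ D := Finset.sum_nonneg fun e _ => mul_nonneg (hc e).le (sq_nonneg _)
  rcases hW0.eq_or_lt with h0 | hWpos
  · rw [← h0, Real.zero_rpow (by positivity)]
    positivity
  -- the sum of the gradients of `w ^ α`
  set T := ∑ e ∈ edgesIn d G, |edgeGrad (fun x => w x ^ α) e| with hT
  have hT0 : 0 ≤ T := Finset.sum_nonneg fun _ _ => abs_nonneg _
  have hgns : W ≤ T ^ ((d : ℝ) / (d - 1)) := by
    have := sum_rpow_le_sum_abs_edgeGrad_rpow hd G (fun x => w x ^ α)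
      (fun x hx => by simp only [hwG x hx]; exact Real.zero_rpow (by linarith))
    refine le_trans (le_of_eq (Finset.sum_congr rfl fun x _ => ?_)) this
    rw [abs_of_nonneg (Real.rpow_nonneg (hw x) _), ← Real.rpow_mul (hw x), hαρ]
  have hWT : W ^ ((d - 1) / d * 2 : ℝ) ≤ T ^ 2 := by
    have h1 := Real.rpow_le_rpow hW0 hgns (z := ((d : ℝ) - 1) / d) (by positivity)
    rw [← Real.rpow_mul hT0, show (d : ℝ) / (d - 1) * ((d - 1) / d) = 1 by field_simp,
      Real.rpow_one] at h1
    rw [Real.rpow_mul hW0, Real.rpow_two]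
    exact pow_le_pow_left₀ (by positivity) h1 2
  set s : EdgeIx d → ℝ := fun e =>
    w e.1 ^ ((α - 1) * 2) + w (e.1 + unitv d e.2) ^ ((α - 1) * 2) with hs
  have hs0 : ∀ e, 0 ≤ s e := fun e =>
    add_nonneg (Real.rpow_nonneg (hw _) _) (Real.rpow_nonneg (hw _) _)
  have hTs : T ^ 2 ≤ (α ^ 2 * D) * (2 * ∑ e ∈ edgesIn d G, (c e)⁻¹ * s e) := by
    have h1 : T ≤ ∑ e ∈ edgesIn d G, (α * (√(c e) * |edgeGrad w e|)) *
        ((√(c e))⁻¹ * (w e.1 ^ (α - 1) + w (e.1 + unitv d e.2) ^ (α - 1))) := by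
      refine Finset.sum_le_sum fun e _ => ?_
      have h := abs_rpow_sub_rpow_le (hw (e.1 + unitv d e.2)) (hw e.1) hα1.le
      have hce : √(c e) ≠ 0 := (Real.sqrt_pos.2 (hc e)).ne'
      refine h.trans (le_of_eq ?_)
      simp only [edgeGrad]
      field_simp
      ring
    have h2 := pow_le_pow_left₀ hT0 h1 2
    refine h2.trans ((Finset.sum_mul_sq_le_sq_mul_sq _ _ _).trans ?_)
    rw [hD, Finset.mul_sum (a := α ^ 2), Finset.mul_sum (a := (2 : ℝ))]
    refine mul_le_mul (Finset.sum_le_sum fun e _ => ?_) (Finset.sum_le_sum fun e _ => ?_)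
      (Finset.sum_nonneg fun _ _ => sq_nonneg _)
      (Finset.sum_nonneg fun e _ => mul_nonneg (sq_nonneg _) (mul_nonneg (hc e).le (sq_nonneg _)))
    · rw [mul_pow, mul_pow, Real.sq_sqrt (hc e).le, sq_abs]
    · rw [mul_pow, inv_pow, Real.sq_sqrt (hc e).le, hs]
      simp only
      rw [Real.rpow_mul (hw _), Real.rpow_mul (hw _), Real.rpow_two, Real.rpow_two]
      have : 0 ≤ (c e)⁻¹ := (inv_pos.2 (hc e)).le
      nlinarith [sq_nonneg (w e.1 ^ (α - 1) - w (e.1 + unitv d e.2) ^ (α - 1)),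
        mul_nonneg this (sq_nonneg (w e.1 ^ (α - 1) - w (e.1 + unitv d e.2) ^ (α - 1)))]
  have hhol : ∑ e ∈ edgesIn d G, (c e)⁻¹ * s e ≤
      K ^ (1 / q) * ((2 ^ (q' - 1) * (2 * d)) * W) ^ (1 / q') := by
    refine (Real.inner_le_Lp_mul_Lq_of_nonneg _ hqq (fun e _ => (inv_pos.2 (hc e)).le)
      (fun e _ => hs0 e)).trans ?_
    have e1 : ∑ e ∈ edgesIn d G, (c e)⁻¹ ^ q = K := by
      refine Finset.sum_congr rfl fun e _ => ?_
      rw [Real.rpow_neg (hc e).le, Real.inv_rpow (hc e).le]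
    rw [e1]
    refine mul_le_mul_of_nonneg_left (Real.rpow_le_rpow
      (Finset.sum_nonneg fun e _ => Real.rpow_nonneg (hs0 e) _) ?_ (by positivity)) (by positivity)
    rw [mul_assoc, hW, ← sum_edgesIn_fst_add_snd G (fun x => w x ^ ρ)
      (fun x hx => by simp only [hwG x hx]; exact Real.zero_rpow hρ0.ne'), Finset.mul_sum]
    refine Finset.sum_le_sum fun e _ => ?_
    refine (add_rpow_le_two_rpow_mul (Real.rpow_nonneg (hw _) _) (Real.rpow_nonneg (hw _) _)
      hq'1.le).trans (le_of_eq ?_)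
    rw [← Real.rpow_mul (hw _), ← Real.rpow_mul (hw _), hαρ']
  have hall : W ^ (2 / ρ) * W ^ (1 / q') ≤
      (2 * α ^ 2 * (2 ^ (q' - 1) * (2 * d)) ^ (1 / q') * K ^ (1 / q) * D) * W ^ (1 / q') := by
    rw [← Real.rpow_add hWpos, ← hexp]
    refine hWT.trans (hTs.trans ?_)
    refine (mul_le_mul_of_nonneg_left (mul_le_mul_of_nonneg_left hhol (by norm_num))
      (by positivity)).trans (le_of_eq ?_)
    rw [Real.mul_rpow (by positivity) hW0]
    ring
  exact le_of_mul_le_mul_right hall (by positivity)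

end WeightedSobolev

section LocalizedSobolev

variable {d : ℕ}

lemma mem_box {r : ℝ} {x : Vert d} : x ∈ box d r ↔ ∀ i, -r ≤ x i ∧ (x i : ℝ) ≤ r := by
  simp [box, Fintype.mem_piFinset, Int.ceil_le, Int.le_floor]

lemma box_subset {r s : ℝ} (h : r ≤ s) : box d r ⊆ box d s := by
  intro x hx
  rw [mem_box] at hx ⊢
  exact fun i => ⟨by linarith [(hx i).1], (hx i).2.trans h⟩

lemma card_box_natCast (n : ℕ) : ((box d (n : ℝ)).card : ℝ) = (2 * n + 1) ^ d := by
  have h1 : ⌈-(n : ℝ)⌉ = -(n : ℤ) := by rw [Int.ceil_neg]; simp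
  rw [box, Fintype.card_piFinset, Finset.prod_const, Finset.card_univ, Fintype.card_fin, h1,
    Int.floor_natCast, Int.card_Icc]
  have : ((n : ℤ) + 1 - -(n : ℤ)).toNat = 2 * n + 1 := by omega
  rw [this]; push_cast; ring

lemma piOf_pos (hd : 2 ≤ d) (ω : EnvSp d) (x : Vert d) : 0 < piOf d ω x :=
  Finset.sum_pos (fun i _ => add_pos (ω.2 _) (ω.2 _)) ⟨⟨0, by omega⟩, Finset.mem_univ _⟩

lemma cR_pos (ω : EnvSp d) (R : ℝ) (e : EdgeIx d) : 0 < cR d ω R e := by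
  unfold cR
  split_ifs
  exacts [ω.2 _, one_pos]

lemma piRloc_pos (hd : 2 ≤ d) (ω : EnvSp d) (R : ℝ) (x : Vert d) : 0 < piRloc d ω R x := by
  have := piOf_pos hd ω x
  unfold piRloc
  split_ifs <;> positivity

lemma one_le_piRloc (hd : 2 ≤ d) (ω : EnvSp d) {R : ℝ} {x : Vert d} (hx : x ∉ box d (2 * R)) :
    1 ≤ piRloc d ω R x := by
  have := piOf_pos hd ω x
  rw [piRloc, if_neg hx]
  split_ifs <;> linarith

lemma piOf_le_piRloc (ω : EnvSp d) {R : ℝ} {x : Vert d} (hx : x ∈ box d (4 * R)) :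
    piOf d ω x ≤ piRloc d ω R x := by
  unfold piRloc
  split_ifs <;> linarith

lemma piRloc_le_one_add (hd : 2 ≤ d) (ω : EnvSp d) (R : ℝ) (x : Vert d) :
    piRloc d ω R x ≤ 1 + piOf d ω x := by
  have := piOf_pos hd ω x
  unfold piRloc
  split_ifs <;> linarith

lemma natCeil_four_mul_le {R : ℝ} (hR : 1 ≤ R) : (⌈4 * R⌉₊ : ℝ) ≤ 5 * R := by
  have := Nat.ceil_lt_add_one (a := 4 * R) (by linarith)
  linarith

lemma exists_card_box_le (d : ℕ) : ∃ C : ℝ, 0 < C ∧ ∀ R : ℝ, 1 ≤ R →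
    ((box d (4 * R)).card : ℝ) ≤ C * R ^ d := by
  refine ⟨11 ^ d, by positivity, fun R hR => ?_⟩
  have h1 : ((box d (4 * R)).card : ℝ) ≤ (box d (⌈4 * R⌉₊ : ℝ)).card := by
    exact_mod_cast Finset.card_le_card (box_subset (Nat.le_ceil _))
  rw [card_box_natCast] at h1
  rw [← mul_pow]
  have := natCeil_four_mul_le hR
  exact h1.trans (pow_le_pow_left₀ (by positivity) (by linarith) d)

lemma exists_sum_edgesIn_rpow_le {ω : EnvSp d} {s : ℝ}
    (h : ∃ C : ℝ, ∀ n : ℕ, 1 ≤ n →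
      (∑ e ∈ edgesIn d (box d (n : ℝ)), ω.1 e ^ s) / (n : ℝ) ^ d ≤ C) :
    ∃ C : ℝ, 0 < C ∧ ∀ R : ℝ, 1 ≤ R → ∑ e ∈ edgesIn d (box d (4 * R)), ω.1 e ^ s ≤ C * R ^ d := by
  obtain ⟨C, hC⟩ := h
  refine ⟨(|C| + 1) * 5 ^ d, by positivity, fun R hR => ?_⟩
  have hn : 1 ≤ ⌈4 * R⌉₊ := Nat.one_le_ceil_iff.2 (by linarith)
  have h1 := hC _ hn
  rw [div_le_iff₀ (by positivity)] at h1
  have h2 : ∑ e ∈ edgesIn d (box d (4 * R)), ω.1 e ^ s ≤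
      ∑ e ∈ edgesIn d (box d (⌈4 * R⌉₊ : ℝ)), ω.1 e ^ s :=
    Finset.sum_le_sum_of_subset_of_nonneg (edgesIn_mono (box_subset (Nat.le_ceil _)))
      fun e _ _ => Real.rpow_nonneg (ω.2 e).le _
  refine h2.trans (h1.trans ?_)
  rw [mul_assoc, ← mul_pow]
  have h3 : C ≤ |C| + 1 := by linarith [le_abs_self C]
  have := natCeil_four_mul_le hR
  gcongr

lemma piOf_rpow_le (hd : 2 ≤ d) (ω : EnvSp d) {p : ℝ} (hp : 1 ≤ p) (x : Vert d) :
    piOf d ω x ^ p ≤ (d : ℝ) ^ (p - 1) * (2 ^ (p - 1) *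
      ∑ i, (ω.1 (x, i) ^ p + ω.1 (x - unitv d i, i) ^ p)) := by
  have h1 := Real.rpow_sum_le_const_mul_sum_rpow_of_nonneg (s := Finset.univ) (p := p)
    (f := fun i => ω.1 (x, i) + ω.1 (x - unitv d i, i)) hp
    (fun i _ => (add_pos (ω.2 _) (ω.2 _)).le)
  rw [Finset.card_univ, Fintype.card_fin] at h1
  refine h1.trans (mul_le_mul_of_nonneg_left ?_ (by positivity))
  rw [Finset.mul_sum]
  exact Finset.sum_le_sum fun i _ => add_rpow_le_two_rpow_mul (ω.2 _).le (ω.2 _).le hp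

lemma sum_sum_incident_le (B : Finset (Vert d)) {f : EdgeIx d → ℝ} (hf : ∀ e, 0 ≤ f e) :
    ∑ x ∈ B, ∑ i, (f (x, i) + f (x - unitv d i, i)) ≤ 2 * ∑ e ∈ edgesIn d B, f e := by
  simp only [Finset.sum_add_distrib]
  have h1 : ∑ x ∈ B, ∑ i, f (x, i) ≤ ∑ e ∈ edgesIn d B, f e := by
    rw [← Finset.sum_product']
    refine Finset.sum_le_sum_of_subset_of_nonneg (fun e he => ?_) fun e _ _ => hf e
    rw [mem_edgesIn]; simp at he; exact Or.inl he
  have h2 : ∑ x ∈ B, ∑ i, f (x - unitv d i, i) ≤ ∑ e ∈ edgesIn d B, f e := by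
    rw [← Finset.sum_product' B Finset.univ fun x i => f (x - unitv d i, i),
      ← Finset.sum_image (s := B ×ˢ (Finset.univ : Finset (Fin d)))
        (g := fun e => (e.1 - unitv d e.2, e.2))]
    · refine Finset.sum_le_sum_of_subset_of_nonneg (fun e he => ?_) fun e _ _ => hf e
      rw [mem_edgesIn]
      simp only [Finset.mem_image, Finset.mem_product, Finset.mem_univ, and_true] at he
      obtain ⟨a, ha, rfl⟩ := he
      right; simpa using ha
    · rintro ⟨x, i⟩ _ ⟨y, j⟩ _ h
      simp only [Prod.mk.injEq] at h
      obtain ⟨h, rfl⟩ := h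
      simpa using h
  linarith

/-- Inverse speed measure grows at most polynomially. -/
lemma exists_one_div_piRloc_le (hd : 2 ≤ d) {p q : ℝ} (hq : 0 < q) {ω : EnvSp d}
    (hω : InOmegaPQ d p q ω) :
    ∃ C : ℝ, 0 < C ∧ ∀ R : ℝ, 1 ≤ R → ∀ x, 1 / piRloc d ω R x ≤ C * R ^ ((d : ℝ) / q) := by
  obtain ⟨C, hC, h⟩ := exists_sum_edgesIn_rpow_le hω.2
  refine ⟨C ^ (1 / q) + 1, by positivity, fun R hR x => ?_⟩
  have hR0 : 0 < R := by linarith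
  have hR1 : 1 ≤ R ^ ((d : ℝ) / q) := Real.one_le_rpow hR (by positivity)
  by_cases hx : x ∈ box d (4 * R)
  · set e : EdgeIx d := (x, ⟨0, by omega⟩) with he
    have h1 : ω.1 e ^ (-q) ≤ C * R ^ d :=
      (Finset.single_le_sum (f := fun e => ω.1 e ^ (-q))
        (fun e _ => Real.rpow_nonneg (ω.2 e).le _) (mem_edgesIn.2 (Or.inl hx))).trans (h R hR)
    have h2 : ω.1 e ≤ piRloc d ω R x := by
      refine le_trans ?_ (piOf_le_piRloc ω hx)
      refine le_trans ?_ (Finset.single_le_sum (f := fun i => ω.1 (x, i) + ω.1 (x - unitv d i, i))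
        (fun i _ => (add_pos (ω.2 _) (ω.2 _)).le) (Finset.mem_univ ⟨0, by omega⟩))
      exact le_add_of_nonneg_right (ω.2 _).le
    have h3 := Real.rpow_le_rpow (Real.rpow_nonneg (ω.2 e).le _) h1 (z := 1 / q) (by positivity)
    rw [← Real.rpow_mul (ω.2 e).le, show -q * (1 / q) = -1 by field_simp, Real.rpow_neg_one,
      Real.mul_rpow hC.le (by positivity), ← Real.rpow_natCast R d, ← Real.rpow_mul hR0.le,
      mul_one_div] at h3
    calc 1 / piRloc d ω R x ≤ 1 / ω.1 e := one_div_le_one_div_of_le (ω.2 e) h2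
      _ = (ω.1 e)⁻¹ := one_div _
      _ ≤ _ := h3
      _ ≤ _ := by gcongr; linarith
  · have h1 := one_le_piRloc hd ω (R := R) (x := x) fun h => hx (box_subset (by linarith) h)
    have h2 : 1 / piRloc d ω R x ≤ 1 := by rw [div_le_one (by linarith)]; exact h1
    have h3 : 0 < C ^ (1 / q) := by positivity
    nlinarith

/-- Moment bounds on sets of localized speed measure at most `R ^ d`. -/
lemma exists_moment_bounds (hd : 2 ≤ d) {p q : ℝ} (hp : 1 ≤ p) {ω : EnvSp d}
    (hω : InOmegaPQ d p q ω) :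
    ∃ C : ℝ, 0 < C ∧ ∀ R : ℝ, 1 ≤ R → ∀ G : Finset (Vert d), ∑ x ∈ G, piRloc d ω R x ≤ R ^ d →
      ∑ x ∈ G, piRloc d ω R x ^ p ≤ C * R ^ d ∧
      ∑ e ∈ edgesIn d G, cR d ω R e ^ (-q) ≤ C * R ^ d := by
  obtain ⟨C₁, hC₁, h₁⟩ := exists_card_box_le d
  obtain ⟨C₂, hC₂, h₂⟩ := exists_sum_edgesIn_rpow_le hω.1
  obtain ⟨C₃, hC₃, h₃⟩ := exists_sum_edgesIn_rpow_le hω.2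
  set K : ℝ := 2 ^ (p - 1) * (C₁ + (d : ℝ) ^ (p - 1) * (2 ^ (p - 1) * (2 * C₂))) with hK
  have hK0 : 0 < K := by positivity
  refine ⟨K + 1 + (C₃ + 2 * d), by positivity, fun R hR G hG => ⟨?_, ?_⟩⟩
  · have hin : ∑ x ∈ box d (4 * R), piRloc d ω R x ^ p ≤ K * R ^ d := by
      calc ∑ x ∈ box d (4 * R), piRloc d ω R x ^ p
          ≤ ∑ x ∈ box d (4 * R), 2 ^ (p - 1) * (1 + (d : ℝ) ^ (p - 1) * (2 ^ (p - 1) *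
              ∑ i, (ω.1 (x, i) ^ p + ω.1 (x - unitv d i, i) ^ p))) := by
            refine Finset.sum_le_sum fun x _ => ?_
            refine (Real.rpow_le_rpow (piRloc_pos hd ω R x).le (piRloc_le_one_add hd ω R x)
              (by linarith)).trans ?_
            refine (add_rpow_le_two_rpow_mul zero_le_one (piOf_pos hd ω x).le hp).trans ?_
            rw [Real.one_rpow]
            have := piOf_rpow_le hd ω hp x
            gcongr
        _ = 2 ^ (p - 1) * ((box d (4 * R)).card + (d : ℝ) ^ (p - 1) * (2 ^ (p - 1) *
              ∑ x ∈ box d (4 * R), ∑ i, (ω.1 (x, i) ^ p + ω.1 (x - unitv d i, i) ^ p))) := by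
            rw [← Finset.mul_sum, Finset.sum_add_distrib, ← Finset.mul_sum, ← Finset.mul_sum]
            simp
        _ ≤ 2 ^ (p - 1) * (C₁ * R ^ d + (d : ℝ) ^ (p - 1) * (2 ^ (p - 1) *
              (2 * (C₂ * R ^ d)))) := by
            have a1 := h₁ R hR
            have a2 := h₂ R hR
            have a3 := sum_sum_incident_le (box d (4 * R)) (f := fun e => ω.1 e ^ p)
              fun e => Real.rpow_nonneg (ω.2 e).le _
            have a4 : ∑ x ∈ box d (4 * R), ∑ i, (ω.1 (x, i) ^ p + ω.1 (x - unitv d i, i) ^ p) ≤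
                2 * (C₂ * R ^ d) := a3.trans (by gcongr)
            gcongr
        _ = K * R ^ d := by rw [hK]; ring
    have hout : ∑ x ∈ G with x ∉ box d (4 * R), piRloc d ω R x ^ p ≤ R ^ d := by
      refine le_trans ?_ hG
      refine le_trans (le_of_eq (Finset.sum_congr rfl fun x hx => ?_))
        (Finset.sum_le_sum_of_subset_of_nonneg (Finset.filter_subset _ G)
          fun x _ _ => (piRloc_pos hd ω R x).le)
      have hx4 := (Finset.mem_filter.1 hx).2
      have hx2 : x ∉ box d (2 * R) := fun h => hx4 (box_subset (by linarith) h)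
      simp [piRloc, hx2, hx4]
    rw [← Finset.sum_filter_add_sum_filter_not G (· ∈ box d (4 * R))]
    have hin' : ∑ x ∈ G with x ∈ box d (4 * R), piRloc d ω R x ^ p ≤ K * R ^ d := by
      refine le_trans (Finset.sum_le_sum_of_subset_of_nonneg (fun x hx => ?_)
        fun x _ _ => Real.rpow_nonneg (piRloc_pos hd ω R x).le _) hin
      exact (Finset.mem_filter.1 hx).2
    have : 0 ≤ (C₃ + 2 * d) * R ^ d := by positivity
    nlinarith
  · have hin : ∑ e ∈ edgesIn d G with e ∈ edgesIn d (box d (2 * R)), cR d ω R e ^ (-q) ≤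
        C₃ * R ^ d := by
      refine le_trans ?_ (h₃ R hR)
      refine le_trans (le_of_eq (Finset.sum_congr rfl fun e he => ?_))
        (Finset.sum_le_sum_of_subset_of_nonneg
          (s := {e ∈ edgesIn d G | e ∈ edgesIn d (box d (2 * R))}) (fun e he => ?_)
          fun e _ _ => Real.rpow_nonneg (ω.2 e).le _)
      · simp [cR, (Finset.mem_filter.1 he).2]
      · exact edgesIn_mono (box_subset (by linarith)) (Finset.mem_filter.1 he).2
    have hout : ∑ e ∈ edgesIn d G with e ∉ edgesIn d (box d (2 * R)), cR d ω R e ^ (-q) ≤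
        2 * d * R ^ d := by
      set g : Vert d → ℝ := fun x => if x ∈ G ∧ x ∉ box d (2 * R) then 1 else 0 with hg
      have hg0 : ∀ x, 0 ≤ g x := fun x => by simp only [hg]; split_ifs <;> norm_num
      calc ∑ e ∈ edgesIn d G with e ∉ edgesIn d (box d (2 * R)), cR d ω R e ^ (-q)
          ≤ ∑ e ∈ edgesIn d G with e ∉ edgesIn d (box d (2 * R)),
              (g e.1 + g (e.1 + unitv d e.2)) := by
            refine Finset.sum_le_sum fun e he => ?_
            rw [Finset.mem_filter] at he
            obtain ⟨he1, he2⟩ := he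
            rw [cR, if_neg he2, Real.one_rpow]
            rw [mem_edgesIn, not_or] at he2
            rcases mem_edgesIn.1 he1 with h | h
            · have : g e.1 = 1 := by simp [hg, h, he2.1]
              linarith [hg0 (e.1 + unitv d e.2)]
            · have : g (e.1 + unitv d e.2) = 1 := by simp only [hg, h, he2.2]; simp
              linarith [hg0 e.1]
        _ ≤ ∑ e ∈ edgesIn d G, (g e.1 + g (e.1 + unitv d e.2)) :=
            Finset.sum_le_sum_of_subset_of_nonneg (Finset.filter_subset _ _)
              fun e _ _ => add_nonneg (hg0 _) (hg0 _)
        _ = 2 * d * ∑ x ∈ G, g x := sum_edgesIn_fst_add_snd G g fun x hx => by simp [hg, hx]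
        _ ≤ 2 * d * ∑ x ∈ G, piRloc d ω R x := by
            gcongr with x hx
            by_cases h : x ∈ box d (2 * R)
            · simpa [hg, h] using (piRloc_pos hd ω R x).le
            · simpa [hg, h, hx] using one_le_piRloc hd ω h
        _ ≤ _ := by gcongr
    rw [← Finset.sum_filter_add_sum_filter_not (edgesIn d G) (· ∈ edgesIn d (box d (2 * R)))]
    have : 0 ≤ (K + 1) * R ^ d := by positivity
    nlinarith

end LocalizedSobolev

section TruncatedSobolev

variable {d : ℕ}

lemma sq_max_sub_zero_sub_le (a b h : ℝ) : (max (a - h) 0 - max (b - h) 0) ^ 2 ≤ (a - b) ^ 2 := by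
  rw [sq_le_sq]
  have := abs_max_sub_max_le_abs (a - h) (b - h) 0
  simpa using this

/-- The exponents in the localized Sobolev inequality. -/
lemma sobolev_exponent_facts (hd : 2 ≤ d) {p q : ℝ}
    (hp : (d : ℝ) / 2 < p) (hq : (d : ℝ) / 2 < q) (hpq : 1 / p + 1 / q < 2 / (d : ℝ)) :
    1 < p ∧ 1 < q ∧ 0 < epsPQ d p q ∧
      2 + epsPQ d p q = 2 * q * d / (q * (d - 2) + d) * (1 - 1 / p) := by
  have hd' : (2 : ℝ) ≤ d := by exact_mod_cast hd
  have hp1 : 1 < p := by linarith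
  have hq1 : 1 < q := by linarith
  have hden : 0 < q * ((d : ℝ) - 2) + d := by nlinarith
  have hden' : 0 < ((d : ℝ) - 2) / d + 1 / q := by
    have : 0 ≤ ((d : ℝ) - 2) / d := div_nonneg (by linarith) (by linarith)
    have : 0 < 1 / q := by positivity
    linarith
  refine ⟨hp1, hq1, ?_, ?_⟩
  · exact div_pos (by linarith) hden'
  · have e : ((d : ℝ) - 2) / d + 1 / q = (q * (d - 2) + d) / (q * d) := by
      have : (d : ℝ) ≠ 0 := by linarith
      field_simp
    have hd0 : (d : ℝ) ≠ 0 := by linarith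
    have hp0 : p ≠ 0 := by linarith
    have hq0 : q ≠ 0 := by linarith
    rw [epsPQ, e]
    field_simp
    ring

set_option maxHeartbeats 1000000 in
/-- The localized Sobolev inequality, with the scaling of the constant made explicit. -/
theorem exists_localized_sobolev (hd : 2 ≤ d) {p q : ℝ}
    (hp : (d : ℝ) / 2 < p) (hq : (d : ℝ) / 2 < q) (hpq : 1 / p + 1 / q < 2 / (d : ℝ))
    {ω : EnvSp d} (hω : InOmegaPQ d p q ω) :
    ∃ C : ℝ, 0 < C ∧ ∀ R : ℝ, 1 ≤ R → ∀ (B : Finset (Vert d)) (v : Vert d → ℝ),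
      (∀ x, 0 ≤ v x) → (∀ x ∉ B, v x = 0) →
      (∑ x ∈ B, piRloc d ω R x * v x ^ (2 + epsPQ d p q)) ^ (2 / (2 + epsPQ d p q)) ≤
        C * R ^ (2 - d + 2 * d / (2 + epsPQ d p q)) *
          (∑ e ∈ edgesIn d B, cR d ω R e * edgeGrad v e ^ 2 +
            1 / R ^ 2 * ∑ x ∈ B, piRloc d ω R x * v x ^ 2) := by
  have hd' : (2 : ℝ) ≤ d := by exact_mod_cast hd
  obtain ⟨hp1, hq1, hε, hS⟩ := sobolev_exponent_facts hd hp hq hpq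
  obtain ⟨C₁, hC₁, h₁⟩ := exists_sum_rpow_le_energy hd hq1
  obtain ⟨C₂, hC₂, h₂⟩ := exists_moment_bounds hd hp1.le hω
  set S := 2 + epsPQ d p q with hSdef
  set ρ := 2 * q * d / (q * (d - 2) + d) with hρ
  have hS2 : 2 < S := by linarith
  have hS0 : 0 < S := by linarith
  have hp0 : 0 < p := by linarith
  have hq0 : 0 < q := by linarith
  have hden : 0 < q * ((d : ℝ) - 2) + d := by nlinarith
  have hρ0 : 0 < ρ := by positivity
  set p' := p / (p - 1) with hp'
  have hp'0 : 0 < p' := div_pos hp0 (by linarith)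
  have hpp : p'.HolderConjugate p := (Real.HolderConjugate.conjExponent hp1).symm
  have hSp' : S * p' = ρ := by
    rw [hS, hp']; have : p - 1 ≠ 0 := by linarith
    field_simp
  have hpowR : (d : ℝ) / q + d * (1 / p * (2 / S)) = 2 - d + 2 * d / S := by
    have e1 : S * (1 / ρ) = 1 - 1 / p := by rw [hS]; field_simp
    have e2 : 2 / ρ = (d - 2) / d + 1 / q := by rw [hρ]; field_simp
    have e3 : 1 / p = 1 - S * (1 / ρ) := by linarith
    have e4 : (d : ℝ) * (2 / ρ) = d - 2 + d / q := by rw [e2]; field_simp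
    rw [e3]
    have : (d : ℝ) * ((1 - S * (1 / ρ)) * (2 / S)) = 2 * d / S - d * (2 / ρ) := by field_simp
    rw [this, e4]; ring
  set C₄ := C₁ * C₂ ^ (1 / q) * C₂ ^ (1 / p * (2 / S)) with hC₄
  have hC₄0 : 0 < C₄ := by positivity
  refine ⟨4 * (C₄ + 1), by positivity, fun R hR B v hv hvB => ?_⟩
  have hR0 : 0 < R := by linarith
  set m := piRloc d ω R with hm
  have hm0 : ∀ x, 0 < m x := piRloc_pos hd ω R
  set D := ∑ e ∈ edgesIn d B, cR d ω R e * edgeGrad v e ^ 2 with hD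
  set N := ∑ x ∈ B, m x * v x ^ 2 with hN
  have hD0 : 0 ≤ D := Finset.sum_nonneg fun e _ => mul_nonneg (cR_pos ω R e).le (sq_nonneg _)
  have hN0 : 0 ≤ N := Finset.sum_nonneg fun x _ => mul_nonneg (hm0 x).le (sq_nonneg _)
  rcases hN0.eq_or_lt with hNz | hNpos
  · have hvz : ∀ x ∈ B, v x = 0 := by
      intro x hx
      have := (Finset.sum_eq_zero_iff_of_nonneg
        (fun x _ => mul_nonneg (hm0 x).le (sq_nonneg (v x)))).1 hNz.symm x hx
      simpa [(hm0 x).ne'] using this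
    have : ∑ x ∈ B, m x * v x ^ S = 0 := Finset.sum_eq_zero fun x hx => by
      rw [hvz x hx, Real.zero_rpow hS0.ne', mul_zero]
    rw [this, Real.zero_rpow (by positivity)]
    positivity
  -- truncation level
  set h := √(N / R ^ d) with hh
  have hh0 : 0 < h := Real.sqrt_pos.2 (by positivity)
  have hhsq : h ^ 2 = N / R ^ d := Real.sq_sqrt (by positivity)
  set w : Vert d → ℝ := fun x => max (v x - h) 0 with hw
  set G := {x ∈ B | h < v x} with hG
  have hw0 : ∀ x, 0 ≤ w x := fun x => le_max_right _ _
  have hwG : ∀ x ∉ G, w x = 0 := by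
    intro x hx
    refine max_eq_right ?_
    by_cases hxB : x ∈ B
    · have : ¬ h < v x := fun hlt => hx (Finset.mem_filter.2 ⟨hxB, hlt⟩)
      linarith
    · rw [hvB x hxB]; linarith
  have hGB : G ⊆ B := Finset.filter_subset _ _
  have hcheb : ∑ x ∈ G, m x ≤ R ^ d := by
    have : h ^ 2 * ∑ x ∈ G, m x ≤ N := by
      rw [Finset.mul_sum]
      refine le_trans (Finset.sum_le_sum fun x hx => ?_)
        (Finset.sum_le_sum_of_subset_of_nonneg hGB
          fun x _ _ => mul_nonneg (hm0 x).le (sq_nonneg (v x)))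
      have hlt := (Finset.mem_filter.1 hx).2
      rw [mul_comm]
      exact mul_le_mul_of_nonneg_left (pow_le_pow_left₀ hh0.le hlt.le 2) (hm0 x).le
    rw [hhsq, div_mul_eq_mul_div, div_le_iff₀ (by positivity)] at this
    exact le_of_mul_le_mul_left this hNpos
  obtain ⟨hmom, hinv⟩ := h₂ R hR G hcheb
  -- the part above the truncation level
  have hDw : ∑ e ∈ edgesIn d G, cR d ω R e * edgeGrad w e ^ 2 ≤ D := by
    refine le_trans (Finset.sum_le_sum_of_subset_of_nonneg (edgesIn_mono hGB)
      fun e _ _ => mul_nonneg (cR_pos ω R e).le (sq_nonneg _)) (Finset.sum_le_sum fun e _ => ?_)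
    exact mul_le_mul_of_nonneg_left (sq_max_sub_zero_sub_le _ _ _) (cR_pos ω R e).le
  have hWρ := h₁ (cR d ω R) (cR_pos ω R) G w hw0 hwG
  set W := ∑ x ∈ G, w x ^ ρ with hW
  have hW0 : 0 ≤ W := Finset.sum_nonneg fun x _ => Real.rpow_nonneg (hw0 x) _
  have hWle : W ^ (2 / ρ) ≤ C₁ * (C₂ * R ^ d) ^ (1 / q) * D := by
    refine hWρ.trans ?_
    have : 0 ≤ ∑ e ∈ edgesIn d G, cR d ω R e ^ (-q) :=
      Finset.sum_nonneg fun e _ => Real.rpow_nonneg (cR_pos ω R e).le _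
    refine mul_le_mul (mul_le_mul_of_nonneg_left (Real.rpow_le_rpow this hinv (by positivity))
      hC₁.le) hDw (Finset.sum_nonneg fun e _ => mul_nonneg (cR_pos ω R e).le (sq_nonneg _)) ?_
    positivity
  have hM0 : 0 ≤ ∑ x ∈ G, m x ^ p := Finset.sum_nonneg fun x _ => Real.rpow_nonneg (hm0 x).le _
  have hhigh : (∑ x ∈ G, m x * w x ^ S) ^ (2 / S) ≤
      C₄ * R ^ (2 - d + 2 * d / S) * D := by
    have hH : ∑ x ∈ G, m x * w x ^ S ≤ W ^ (1 / p') * (∑ x ∈ G, m x ^ p) ^ (1 / p) := by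
      refine le_trans (le_of_eq (Finset.sum_congr rfl fun x _ => mul_comm _ _))
        ((Real.inner_le_Lp_mul_Lq_of_nonneg G hpp (fun x _ => Real.rpow_nonneg (hw0 x) S)
          (fun x _ => (hm0 x).le)).trans (le_of_eq ?_))
      congr 2
      refine Finset.sum_congr rfl fun x _ => ?_
      rw [← Real.rpow_mul (hw0 x), hSp']
    refine (Real.rpow_le_rpow (Finset.sum_nonneg fun x _ =>
      mul_nonneg (hm0 x).le (Real.rpow_nonneg (hw0 x) _)) hH (by positivity)).trans ?_
    rw [Real.mul_rpow (by positivity) (by positivity), ← Real.rpow_mul hW0, ← Real.rpow_mul hM0,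
      show 1 / p' * (2 / S) = 2 / ρ by rw [← hSp']; field_simp]
    have hpow : C₁ * (C₂ * R ^ d) ^ (1 / q) * D * (C₂ * R ^ d) ^ (1 / p * (2 / S)) =
        C₄ * R ^ (2 - d + 2 * d / S) * D := by
      rw [Real.mul_rpow hC₂.le (by positivity), Real.mul_rpow hC₂.le (by positivity), ← hpowR,
        Real.rpow_add hR0, Real.rpow_mul hR0.le d (1 / p * (2 / S)), Real.rpow_natCast,
        show (d : ℝ) / q = d * (1 / q) by ring, Real.rpow_mul hR0.le d (1 / q), Real.rpow_natCast,
        hC₄]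
      ring
    rw [← hpow]
    exact mul_le_mul hWle (Real.rpow_le_rpow hM0 hmom (by positivity)) (by positivity)
      (by positivity)
  -- the part below the truncation level
  have hlow : (∑ x ∈ B, m x * min (v x) h ^ S) ^ (2 / S) ≤
      R ^ (2 - d + 2 * d / S) * (1 / R ^ 2 * N) := by
    have h1 : ∑ x ∈ B, m x * min (v x) h ^ S ≤ h ^ (S - 2) * N := by
      rw [hN, Finset.mul_sum]
      refine Finset.sum_le_sum fun x _ => ?_
      have hmin0 : 0 ≤ min (v x) h := le_min (hv x) hh0.le
      have e : min (v x) h ^ S = min (v x) h ^ (S - 2) * min (v x) h ^ 2 := by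
        rw [← Real.rpow_two, ← Real.rpow_add' hmin0 (by linarith)]; congr 1; ring
      rw [e]
      have a1 : min (v x) h ^ (S - 2) ≤ h ^ (S - 2) :=
        Real.rpow_le_rpow hmin0 (min_le_right _ _) (by linarith)
      have a2 : min (v x) h ^ 2 ≤ v x ^ 2 := pow_le_pow_left₀ hmin0 (min_le_left _ _) 2
      have a3 : 0 ≤ h ^ (S - 2) := by positivity
      calc m x * (min (v x) h ^ (S - 2) * min (v x) h ^ 2)
          ≤ m x * (h ^ (S - 2) * v x ^ 2) := mul_le_mul_of_nonneg_left
            (mul_le_mul a1 a2 (by positivity) a3) (hm0 x).le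
        _ = _ := by ring
    have h2 : h ^ (S - 2) = (N / R ^ d) ^ ((S - 2) / 2) := by
      rw [← hhsq, ← Real.rpow_two, ← Real.rpow_mul hh0.le]; congr 1; ring
    refine (Real.rpow_le_rpow (Finset.sum_nonneg fun x _ => mul_nonneg (hm0 x).le
      (Real.rpow_nonneg (le_min (hv x) hh0.le) _)) h1 (by positivity)).trans (le_of_eq ?_)
    rw [h2, Real.mul_rpow (by positivity) hN0, ← Real.rpow_mul (by positivity),
      Real.div_rpow hN0 (by positivity), div_mul_eq_mul_div, ← Real.rpow_add hNpos,
      show (S - 2) / 2 * (2 / S) + 2 / S = 1 by field_simp; ring, Real.rpow_one,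
      ← Real.rpow_natCast R d, ← Real.rpow_mul hR0.le, ← Real.rpow_two, one_div,
      ← Real.rpow_neg hR0.le, div_eq_mul_inv N, ← Real.rpow_neg hR0.le,
      ← mul_assoc (R ^ (2 - (d : ℝ) + 2 * d / S)), ← Real.rpow_add hR0, mul_comm N]
    congr 2
    field_simp
    ring
  have hsplit : ∑ x ∈ B, m x * v x ^ S ≤
      2 ^ S * (∑ x ∈ G, m x * w x ^ S + ∑ x ∈ B, m x * min (v x) h ^ S) := by
    have e : ∑ x ∈ G, m x * w x ^ S = ∑ x ∈ B, m x * w x ^ S :=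
      Finset.sum_subset hGB fun x _ hx => by rw [hwG x hx, Real.zero_rpow hS0.ne', mul_zero]
    rw [e, ← Finset.sum_add_distrib, Finset.mul_sum]
    refine Finset.sum_le_sum fun x _ => ?_
    have hmin0 : 0 ≤ min (v x) h := le_min (hv x) hh0.le
    have hsum : v x = w x + min (v x) h := by
      rcases le_total (v x) h with hle | hle
      · simp [hw, hle]
      · simp [hw, hle]
    have := add_rpow_le_two_rpow_mul (hw0 x) hmin0 (r := S) (by linarith)
    rw [← hsum] at this
    have h2S : (2 : ℝ) ^ (S - 1) ≤ 2 ^ S :=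
      Real.rpow_le_rpow_of_exponent_le (by norm_num) (by linarith)
    calc m x * v x ^ S ≤ m x * (2 ^ S * (w x ^ S + min (v x) h ^ S)) := by
          refine mul_le_mul_of_nonneg_left (this.trans ?_) (hm0 x).le
          exact mul_le_mul_of_nonneg_right h2S
            (add_nonneg (Real.rpow_nonneg (hw0 x) _) (Real.rpow_nonneg hmin0 _))
      _ = _ := by ring
  have hs1 : 0 ≤ ∑ x ∈ G, m x * w x ^ S :=
    Finset.sum_nonneg fun x _ => mul_nonneg (hm0 x).le (Real.rpow_nonneg (hw0 x) _)
  have hs2 : 0 ≤ ∑ x ∈ B, m x * min (v x) h ^ S :=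
    Finset.sum_nonneg fun x _ => mul_nonneg (hm0 x).le (Real.rpow_nonneg (le_min (hv x) hh0.le) _)
  have hs0 : 0 ≤ ∑ x ∈ B, m x * v x ^ S :=
    Finset.sum_nonneg fun x _ => mul_nonneg (hm0 x).le (Real.rpow_nonneg (hv x) _)
  have h2S : ((2 : ℝ) ^ S) ^ (2 / S) = 4 := by
    rw [← Real.rpow_mul (by norm_num), show S * (2 / S) = 2 by field_simp, Real.rpow_two]; norm_num
  have hsub := Real.rpow_add_le_add_rpow hs1 hs2 (p := 2 / S) (by positivity)
    (by rw [div_le_one hS0]; exact hS2.le)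
  have hfin := Real.rpow_le_rpow hs0 hsplit (z := 2 / S) (by positivity)
  rw [Real.mul_rpow (by positivity) (by positivity), h2S] at hfin
  have hP : 0 < R ^ (2 - d + 2 * d / S) := by positivity
  have hT : 0 ≤ 1 / R ^ 2 * N := by positivity
  calc _ ≤ _ := hfin
    _ ≤ 4 * (C₄ * R ^ (2 - d + 2 * d / S) * D + R ^ (2 - d + 2 * d / S) * (1 / R ^ 2 * N)) := by
        linarith
    _ ≤ _ := by
        have := mul_nonneg hP.le hD0
        have := mul_nonneg hC₄0.le (mul_nonneg hP.le hT)
        nlinarith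

end TruncatedSobolev

section LocalizedGenerator

variable {d : ℕ}

/-- The localized conductance between two vertices. -/
def condR (d : ℕ) (ω : EnvSp d) (R : ℝ) (x y : Vert d) : ℝ :=
  ∑ i, ((if y = x + unitv d i then cR d ω R (x, i) else 0) +
    (if x = y + unitv d i then cR d ω R (y, i) else 0))

/-- The total localized conductance of the edges at a vertex. -/
def totR (d : ℕ) (ω : EnvSp d) (R : ℝ) (x : Vert d) : ℝ :=
  ∑ i, (cR d ω R (x, i) + cR d ω R (x - unitv d i, i))

/-- The generator of `Y^R` killed outside a finite set of vertices. -/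
def killedGen (d : ℕ) (ω : EnvSp d) (R : ℝ) (B : Finset (Vert d)) : Matrix B B ℝ :=
  fun x y => qmatR d ω R x y

lemma condR_comm (ω : EnvSp d) (R : ℝ) (x y : Vert d) : condR d ω R x y = condR d ω R y x :=
  Finset.sum_congr rfl fun _ _ => add_comm _ _

lemma condR_nonneg (ω : EnvSp d) (R : ℝ) (x y : Vert d) : 0 ≤ condR d ω R x y :=
  Finset.sum_nonneg fun i _ => by
    have := (cR_pos ω R (x, i)).le
    have := (cR_pos ω R (y, i)).le
    split_ifs <;> positivity

lemma unitv_ne_zero (i : Fin d) : unitv d i ≠ 0 := fun h => by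
  simpa [unitv] using congrFun h i

lemma condR_self (ω : EnvSp d) (R : ℝ) (x : Vert d) : condR d ω R x x = 0 :=
  Finset.sum_eq_zero fun i _ => by simp [unitv_ne_zero]

lemma condR_eq_zero (ω : EnvSp d) (R : ℝ) {x y : Vert d} (h : y ∉ nbrs d x) :
    condR d ω R x y = 0 := by
  refine Finset.sum_eq_zero fun i _ => ?_
  simp only [nbrs, Finset.mem_union, Finset.mem_image, Finset.mem_univ, true_and, not_or,
    not_exists] at h
  rw [if_neg fun he => h.1 i he.symm, if_neg fun he => h.2 i (by rw [he]; simp), add_zero]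

lemma sum_nbrs_condR (ω : EnvSp d) (R : ℝ) (x : Vert d) :
    ∑ z ∈ nbrs d x, condR d ω R x z = totR d ω R x := by
  simp only [condR, totR]
  rw [Finset.sum_comm]
  refine Finset.sum_congr rfl fun i _ => ?_
  have h1 : x + unitv d i ∈ nbrs d x := by simp [nbrs]
  have h2 : x - unitv d i ∈ nbrs d x := by simp [nbrs]
  rw [Finset.sum_add_distrib, Finset.sum_ite_eq', if_pos h1,
    Finset.sum_eq_single_of_mem _ h2, if_pos (by simp)]
  intro z _ hz
  exact if_neg fun he => hz (by rw [he]; simp)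

lemma qmatR_eq (ω : EnvSp d) (R : ℝ) (x y : Vert d) :
    qmatR d ω R x y =
      (condR d ω R x y - if x = y then totR d ω R x else 0) / piRloc d ω R x := by
  unfold qmatR
  split_ifs with h
  · subst h
    rw [condR_self, ← sum_nbrs_condR, zero_sub, neg_div, Finset.sum_div]
    rfl
  · rw [sub_zero]; rfl

lemma piRloc_mul_qmatR (hd : 2 ≤ d) (ω : EnvSp d) (R : ℝ) (x y : Vert d) :
    piRloc d ω R x * qmatR d ω R x y =
      condR d ω R x y - if x = y then totR d ω R x else 0 := by
  rw [qmatR_eq, mul_div_cancel₀ _ (piRloc_pos hd ω R x).ne']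

lemma totR_le (hd : 2 ≤ d) (ω : EnvSp d) {R : ℝ} (hR : 1 ≤ R) (x : Vert d) :
    totR d ω R x ≤ 2 * d * piRloc d ω R x := by
  have hd' : (2 : ℝ) ≤ d := by exact_mod_cast hd
  have hpi := piOf_pos hd ω x
  by_cases h2 : x ∈ box d (2 * R)
  · have e : totR d ω R x = piRloc d ω R x := by
      rw [piRloc, if_pos h2]
      refine Finset.sum_congr rfl fun i _ => ?_
      rw [cR, cR, if_pos (mem_edgesIn.2 (Or.inl h2)),
        if_pos (mem_edgesIn.2 (Or.inr (by simpa using h2)))]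
    rw [e]
    have := piRloc_pos hd ω R x
    nlinarith
  by_cases h4 : x ∈ box d (4 * R)
  · have hc : ∀ e, cR d ω R e ≤ 1 + ω.1 e := fun e => by
      have := ω.2 e
      unfold cR
      split_ifs <;> linarith
    have h1 : totR d ω R x ≤ ∑ i, ((1 + ω.1 (x, i)) + (1 + ω.1 (x - unitv d i, i))) :=
      Finset.sum_le_sum fun i _ => add_le_add (hc _) (hc _)
    have h3 : ∑ i, ((1 + ω.1 (x, i)) + (1 + ω.1 (x - unitv d i, i))) = 2 * d + piOf d ω x := by
      simp only [piOf, Finset.sum_add_distrib, Finset.sum_const, Finset.card_univ, Fintype.card_fin,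
        nsmul_eq_mul]
      ring
    rw [piRloc, if_neg h2, if_pos h4]
    nlinarith
  · have hout : ∀ y : Vert d, (∀ j, |(y j : ℝ) - x j| ≤ 1) → y ∉ box d (2 * R) := by
      intro y hy hyB
      refine h4 (mem_box.2 fun j => ?_)
      have h1 := mem_box.1 hyB j
      have h3 := abs_le.1 (hy j)
      constructor <;> linarith
    have hu : ∀ i j, |((unitv d i j : ℤ) : ℝ)| ≤ 1 := fun i j => by
      unfold unitv; split_ifs <;> simp
    have e : totR d ω R x = 2 * d := by
      have : ∀ i, cR d ω R (x, i) + cR d ω R (x - unitv d i, i) = 2 := fun i => by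
        rw [cR, cR, if_neg, if_neg]
        · norm_num
        · rw [mem_edgesIn, not_or]
          refine ⟨hout _ fun j => ?_, by simpa using h2⟩
          simpa using hu i j
        · rw [mem_edgesIn, not_or]
          refine ⟨h2, hout _ fun j => ?_⟩
          simpa using hu i j
      simp only [totR, this, Finset.sum_const, Finset.card_univ, Fintype.card_fin, nsmul_eq_mul]
      ring
    rw [e, piRloc, if_neg h2, if_neg h4, mul_one]

lemma isRevGen_killedGen (hd : 2 ≤ d) (ω : EnvSp d) {R : ℝ} (hR : 1 ≤ R) (B : Finset (Vert d)) :
    IsRevGen (killedGen d ω R B) (fun x => piRloc d ω R x) (2 * d) where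
  pos x := piRloc_pos hd ω R x
  offdiag x y hxy := by
    have hne : (x : Vert d) ≠ y := fun h => hxy (Subtype.ext h)
    rw [killedGen, qmatR_eq, if_neg hne, sub_zero]
    exact div_nonneg (condR_nonneg _ _ _ _) (piRloc_pos hd ω R x).le
  symm x y := by
    simp only [killedGen, piRloc_mul_qmatR hd]
    rw [condR_comm]
    by_cases h : (x : Vert d) = y
    · rw [h]
    · rw [if_neg h, if_neg (Ne.symm h)]
  rowsum x := by
    simp only [killedGen, qmatR_eq]
    rw [← Finset.sum_div]
    refine div_nonpos_of_nonpos_of_nonneg ?_ (piRloc_pos hd ω R x).le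
    rw [Finset.sum_coe_sort B
      (fun y => condR d ω R x y - if (x : Vert d) = y then totR d ω R x else 0),
      Finset.sum_sub_distrib, Finset.sum_ite_eq, if_pos x.2, ← sum_nbrs_condR, sub_nonpos]
    calc ∑ y ∈ B, condR d ω R x y ≤ ∑ y ∈ B ∪ nbrs d x, condR d ω R x y :=
          Finset.sum_le_sum_of_subset_of_nonneg Finset.subset_union_left
            fun y _ _ => condR_nonneg _ _ _ _
      _ = ∑ y ∈ nbrs d x, condR d ω R x y :=
          (Finset.sum_subset Finset.subset_union_right fun y _ hy => condR_eq_zero _ _ hy).symm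
  diag x := by
    rw [killedGen, qmatR_eq, condR_self, if_pos rfl, zero_sub, neg_div, neg_le_neg_iff,
      div_le_iff₀ (piRloc_pos hd ω R x)]
    exact totR_le hd ω hR x

lemma genEnergy_killedGen (hd : 2 ≤ d) (ω : EnvSp d) (R : ℝ) (B : Finset (Vert d))
    {v : Vert d → ℝ} (hv : ∀ x ∉ B, v x = 0) :
    genEnergy (killedGen d ω R B) (fun x => piRloc d ω R x) (fun x => v x) =
      ∑ e ∈ edgesIn d B, cR d ω R e * edgeGrad v e ^ 2 := by
  have h1 : ∑ x ∈ B, totR d ω R x * v x ^ 2 =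
      ∑ e ∈ edgesIn d B, (cR d ω R e * v e.1 ^ 2 + cR d ω R e * v (e.1 + unitv d e.2) ^ 2) := by
    rw [Finset.sum_add_distrib, sum_edgesIn_eq_sum_fst fun e he => by simp [hv _ he],
      sum_edgesIn_eq_sum_snd (F := fun e => cR d ω R e * v (e.1 + unitv d e.2) ^ 2)
        fun e he => by simp [hv _ he]]
    simp only [sub_add_cancel, totR, Finset.sum_mul, Finset.sum_add_distrib, add_mul]
  have hterm : ∀ x i, ∑ y ∈ B, (if y = x + unitv d i then cR d ω R (x, i) else 0) * (v x * v y) =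
      cR d ω R (x, i) * (v x * v (x + unitv d i)) := by
    intro x i
    simp only [ite_mul, zero_mul]
    rw [Finset.sum_ite_eq']
    split_ifs with h
    · rfl
    · simp [hv _ h]
  have hfst : ∑ x ∈ B, ∑ y ∈ B, ∑ i,
      (if y = x + unitv d i then cR d ω R (x, i) else 0) * (v x * v y) =
      ∑ e ∈ edgesIn d B, cR d ω R e * (v e.1 * v (e.1 + unitv d e.2)) := by
    rw [sum_edgesIn_eq_sum_fst fun e he => by simp [hv _ he]]
    refine Finset.sum_congr rfl fun x _ => ?_
    rw [Finset.sum_comm]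
    exact Finset.sum_congr rfl fun i _ => hterm x i
  have h2 : ∑ x ∈ B, ∑ y ∈ B, condR d ω R x y * (v x * v y) =
      2 * ∑ e ∈ edgesIn d B, cR d ω R e * (v e.1 * v (e.1 + unitv d e.2)) := by
    simp only [condR, Finset.sum_mul, add_mul, Finset.sum_add_distrib]
    rw [hfst, Finset.sum_comm (s := B) (t := B), two_mul]
    congr 1
    rw [← hfst]
    refine Finset.sum_congr rfl fun x _ => Finset.sum_congr rfl fun y _ =>
      Finset.sum_congr rfl fun i _ => ?_
    rw [mul_comm (v x)]
  have h3 : genEnergy (killedGen d ω R B) (fun x => piRloc d ω R x) (fun x => v x) =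
      -∑ x ∈ B, ∑ y ∈ B, piRloc d ω R x * qmatR d ω R x y * (v x * v y) := by
    rw [genEnergy, ← Finset.sum_coe_sort B]
    congr 1
    refine Finset.sum_congr rfl fun x _ => ?_
    rw [← Finset.sum_coe_sort B]
    rfl
  rw [h3]
  simp only [piRloc_mul_qmatR hd, sub_mul, Finset.sum_sub_distrib, ite_mul, zero_mul]
  rw [h2]
  have h4 : ∑ x ∈ B, ∑ y ∈ B, (if x = y then totR d ω R x * (v x * v y) else 0) =
      ∑ x ∈ B, totR d ω R x * v x ^ 2 := by
    refine Finset.sum_congr rfl fun x hx => ?_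
    rw [Finset.sum_ite_eq, if_pos hx, sq]
  rw [h4, h1, neg_sub, Finset.mul_sum, ← Finset.sum_sub_distrib]
  refine Finset.sum_congr rfl fun e _ => ?_
  rw [edgeGrad]
  ring

/-- The killed generators satisfy a Sobolev inequality with scale-explicit constants. -/
theorem exists_sobolevIneq_killedGen (hd : 2 ≤ d) {p q : ℝ}
    (hp : (d : ℝ) / 2 < p) (hq : (d : ℝ) / 2 < q) (hpq : 1 / p + 1 / q < 2 / (d : ℝ))
    {ω : EnvSp d} (hω : InOmegaPQ d p q ω) :
    ∃ C : ℝ, 0 < C ∧ ∀ R : ℝ, 1 ≤ R → ∀ B : Finset (Vert d),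
      SobolevIneq (killedGen d ω R B) (fun x => piRloc d ω R x) (2 + epsPQ d p q)
        (C * R ^ (2 - d + 2 * d / (2 + epsPQ d p q))) (1 / R ^ 2) := by
  obtain ⟨C, hC, h⟩ := exists_localized_sobolev hd hp hq hpq hω
  have hε := (sobolev_exponent_facts hd hp hq hpq).2.2.1
  refine ⟨C, hC, fun R hR B v hv => ?_⟩
  set u : Vert d → ℝ := fun x => if hx : x ∈ B then v ⟨x, hx⟩ else 0 with hu
  have hu0 : ∀ x, 0 ≤ u x := fun x => by
    simp only [hu]; split_ifs; exacts [hv _, le_rfl]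
  have huB : ∀ x ∉ B, u x = 0 := fun x hx => by simp [hu, hx]
  have huv : (fun x : B => u x) = v := by
    ext x; simp [hu]
  have key := h R hR B u hu0 huB
  rw [← genEnergy_killedGen hd ω R B huB, huv, ← Finset.sum_coe_sort B, ← Finset.sum_coe_sort B]
    at key
  have huv' : ∀ x : B, u x = v x := fun x => congrFun huv x
  simpa only [huv'] using key

lemma l1_neg (x : Vert d) : l1 d (-x) = l1 d x := by simp [l1]

lemma l1_add_le (x y : Vert d) : l1 d (x + y) ≤ l1 d x + l1 d y := by
  rw [l1, l1, l1, ← Finset.sum_add_distrib]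
  refine Finset.sum_le_sum fun i _ => ?_
  simpa using abs_add_le (x i : ℝ) (y i)

lemma l1_unitv (i : Fin d) : l1 d (unitv d i) = 1 := by
  simp [l1, unitv, apply_ite]

lemma l1_sub_eq_one_of_mem_nbrs {x y : Vert d} (h : y ∈ nbrs d x) : l1 d (x - y) = 1 := by
  simp only [nbrs, Finset.mem_union, Finset.mem_image, Finset.mem_univ, true_and] at h
  rcases h with ⟨i, rfl⟩ | ⟨i, rfl⟩
  · rw [← l1_unitv i, ← l1_neg]; congr 1; simp
  · rw [← l1_unitv i]; congr 1; simp

lemma jumpLip_killedGen (ω : EnvSp d) (R : ℝ) (B : Finset (Vert d)) {φ : Vert d → ℝ} {Λ : ℝ}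
    (hφ : ∀ x y, |φ x - φ y| ≤ Λ * l1 d (x - y)) :
    JumpLip (killedGen d ω R B) (fun x => φ x) Λ := by
  intro x y hxy hQ
  have hne : (x : Vert d) ≠ y := fun h => hxy (Subtype.ext h)
  have hmem : (y : Vert d) ∈ nbrs d x := by
    by_contra hn
    refine hQ ?_
    rw [killedGen, qmatR_eq, if_neg hne, condR_eq_zero _ _ hn]
    simp
  have := hφ x y
  rwa [l1_sub_eq_one_of_mem_nbrs hmem, mul_one] at this

end LocalizedGenerator

section KilledLimit

variable {d : ℕ}

lemma IsRevGen.abs_pow_apply_le {ι : Type*} [Fintype ι] [DecidableEq ι] {Q : Matrix ι ι ℝ}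
    {m : ι → ℝ} {b : ℝ} (h : IsRevGen Q m b) (hb : 0 ≤ b) (k : ℕ) (x y : ι) :
    |(Q ^ k) x y| ≤ (2 * b) ^ k := by
  have hrow : ∀ x, ∑ z, |Q x z| ≤ 2 * b := by
    intro x
    have h1 := h.rowsum x
    have h2 := h.diag x
    have h3 : ∀ z ∈ Finset.univ.erase x, |Q x z| = Q x z := fun z hz =>
      abs_of_nonneg (h.offdiag x z (Finset.ne_of_mem_erase hz).symm)
    have h4 : 0 ≤ ∑ z ∈ Finset.univ.erase x, Q x z :=
      Finset.sum_nonneg fun z hz => h.offdiag x z (Finset.ne_of_mem_erase hz).symm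
    rw [← Finset.add_sum_erase _ _ (Finset.mem_univ x)] at h1 ⊢
    rw [Finset.sum_congr rfl h3, abs_of_nonpos (by linarith)]
    linarith
  induction k generalizing x with
  | zero =>
    rw [pow_zero, pow_zero, Matrix.one_apply]
    split_ifs <;> simp
  | succ k ih =>
    rw [pow_succ', Matrix.mul_apply]
    calc |∑ z, Q x z * (Q ^ k) z y| ≤ ∑ z, |Q x z * (Q ^ k) z y| := Finset.abs_sum_le_sum_abs _ _
      _ ≤ ∑ z, |Q x z| * (2 * b) ^ k := by
          refine Finset.sum_le_sum fun z _ => ?_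
          rw [abs_mul]
          exact mul_le_mul_of_nonneg_left (ih z) (abs_nonneg _)
      _ ≤ 2 * b * (2 * b) ^ k := by
          rw [← Finset.sum_mul]
          exact mul_le_mul_of_nonneg_right (hrow x) (by positivity)
      _ = _ := (pow_succ' _ _).symm

/-- Finite sets of vertices exhausting `ℤ^d` by successively adding neighbours. -/
def growNbrs (d : ℕ) (B : Finset (Vert d)) : ℕ → Finset (Vert d)
  | 0 => B
  | n + 1 => growNbrs d B n ∪ (growNbrs d B n).biUnion (nbrs d)

lemma growNbrs_mono (B : Finset (Vert d)) : Monotone (growNbrs d B) :=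
  monotone_nat_of_le_succ fun _ => Finset.subset_union_left

lemma qmatR_eq_zero (ω : EnvSp d) (R : ℝ) {x z : Vert d} (h : z ∉ insert x (nbrs d x)) :
    qmatR d ω R x z = 0 := by
  rw [Finset.mem_insert, not_or] at h
  rw [qmatR_eq, condR_eq_zero _ _ h.2, if_neg (Ne.symm h.1)]
  simp

lemma killedGen_pow_eq_qiter (ω : EnvSp d) (R : ℝ) (B : Finset (Vert d)) (n : ℕ)
    (y : growNbrs d B n) (k j : ℕ) (hjk : j + k ≤ n) (z : growNbrs d B n)
    (hz : (z : Vert d) ∈ growNbrs d B j) :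
    (killedGen d ω R (growNbrs d B n) ^ k) z y = qiter d ω R k z y := by
  induction k generalizing j z with
  | zero =>
    rw [pow_zero, Matrix.one_apply, qiter]
    exact if_congr Subtype.ext_iff rfl rfl
  | succ k ih =>
    have hsub : insert (z : Vert d) (nbrs d z) ⊆ growNbrs d B (j + 1) := by
      intro w hw
      rcases Finset.mem_insert.1 hw with rfl | hw
      · exact Finset.mem_union_left _ hz
      · exact Finset.mem_union_right _ (Finset.mem_biUnion.2 ⟨z, hz, hw⟩)
    have hsubn : insert (z : Vert d) (nbrs d z) ⊆ growNbrs d B n :=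
      hsub.trans (growNbrs_mono B (by omega))
    rw [pow_succ', Matrix.mul_apply, qiter]
    calc ∑ w, killedGen d ω R (growNbrs d B n) z w *
          (killedGen d ω R (growNbrs d B n) ^ k) w y
        = ∑ w : growNbrs d B n, qmatR d ω R z w * qiter d ω R k w y := by
          refine Finset.sum_congr rfl fun w _ => ?_
          by_cases hw : (w : Vert d) ∈ insert (z : Vert d) (nbrs d z)
          · rw [ih (j + 1) (by omega) w (hsub hw)]; rfl
          · rw [killedGen, qmatR_eq_zero ω R hw, zero_mul, zero_mul]
      _ = ∑ w ∈ growNbrs d B n, qmatR d ω R z w * qiter d ω R k w y :=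
          Finset.sum_coe_sort _ (fun w => qmatR d ω R z w * qiter d ω R k w y)
      _ = _ := (Finset.sum_subset hsubn fun w _ hw => by rw [qmatR_eq_zero ω R hw, zero_mul]).symm

/-- Bounds on the heat kernels of all killed chains pass to the heat kernel of `Y^R`. -/
lemma hkR_le_of_killedGen (hd : 2 ≤ d) (ω : EnvSp d) {R : ℝ} (hR : 1 ≤ R) {t : ℝ} (ht : 0 ≤ t)
    (x y : Vert d) {M : ℝ}
    (h : ∀ (B : Finset (Vert d)) (hx : x ∈ B) (hy : y ∈ B),
      NormedSpace.exp (t • killedGen d ω R B) ⟨x, hx⟩ ⟨y, hy⟩ ≤ M) :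
    hkR d ω R t x y ≤ M := by
  have hx : ∀ n, x ∈ growNbrs d {x, y} n := fun n =>
    growNbrs_mono {x, y} (Nat.zero_le n) (by simp [growNbrs])
  have hy : ∀ n, y ∈ growNbrs d {x, y} n := fun n =>
    growNbrs_mono {x, y} (Nat.zero_le n) (by simp [growNbrs])
  have hlim : Tendsto (fun n => ∑' k : ℕ, t ^ k / (Nat.factorial k : ℝ) *
      (killedGen d ω R (growNbrs d {x, y} n) ^ k) ⟨x, hx n⟩ ⟨y, hy n⟩) atTop
      (𝓝 (hkR d ω R t x y)) := by
    refine tendsto_tsum_of_dominated_convergence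
      (bound := fun k : ℕ => (2 * (2 * d) * t) ^ k / (Nat.factorial k : ℝ))
      (Real.summable_pow_div_factorial _) (fun k => ?_) (Eventually.of_forall fun n k => ?_)
    · refine tendsto_const_nhds.congr' ?_
      filter_upwards [eventually_ge_atTop k] with n hn
      rw [killedGen_pow_eq_qiter ω R {x, y} n ⟨y, hy n⟩ k 0 (by omega) ⟨x, hx n⟩ (hx 0)]
    · have h1 := (isRevGen_killedGen hd ω hR (growNbrs d {x, y} n)).abs_pow_apply_le
        (by positivity) k ⟨x, hx n⟩ ⟨y, hy n⟩
      rw [Real.norm_eq_abs, abs_mul, abs_of_nonneg (by positivity), mul_pow, div_mul_eq_mul_div,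
        mul_comm]
      gcongr
  refine le_of_tendsto hlim (Eventually.of_forall fun n => ?_)
  rw [(hasSum_exp_smul_apply _ _ _ _).tsum_eq]
  exact h _ (hx n) (hy n)

end KilledLimit

/-! ### Assembly of the off-diagonal bound -/

section Assembly

lemma sq_mul_exp_neg_le {x : ℝ} (hx : 0 ≤ x) : x ^ 2 * Real.exp (-x) ≤ 2 := by
  have h := Real.quadratic_le_exp_of_nonneg hx
  rw [Real.exp_neg, ← div_eq_mul_inv, div_le_iff₀ (Real.exp_pos x)]
  linarith

lemma sq_log_le {R : ℝ} (hR : 1 ≤ R) : Real.log R ^ 2 ≤ 4 * R := by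
  have h0 : 0 < R := by linarith
  have h1 : Real.log R ≤ 2 * √R := by
    have h2 := Real.log_le_sub_one_of_pos (Real.sqrt_pos.2 h0)
    rw [Real.log_sqrt h0.le] at h2
    linarith
  calc Real.log R ^ 2 ≤ (2 * √R) ^ 2 := pow_le_pow_left₀ (Real.log_nonneg hR) h1 2
    _ = 4 * R := by rw [mul_pow, Real.sq_sqrt h0.le]; norm_num

lemma rpow_le_max_one {c s : ℝ} (hc : 0 ≤ c) (hs0 : 0 ≤ s) (hs1 : s ≤ 1) :
    c ^ s ≤ max 1 c := by
  calc c ^ s ≤ (max 1 c) ^ s := Real.rpow_le_rpow hc (le_max_right _ _) hs0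
    _ ≤ (max 1 c) ^ (1 : ℝ) := Real.rpow_le_rpow_of_exponent_le (le_max_left _ _) hs1
    _ = max 1 c := Real.rpow_one _

/-- Interpolating an on-diagonal bound against a polynomially growing one costs only a constant
when the interpolation parameter `s` is at most `L / (5 κ R)`. -/
lemma interpolation_le {c Cm δ ν γ κ R L s w : ℝ} (hc : 0 ≤ c) (hCm : 0 ≤ Cm)
    (hδν : 0 ≤ δ + ν) (hγ : 0 < γ) (hκ : 0 < κ) (hR : 1 ≤ R) (hL : 0 ≤ L) (hs0 : 0 ≤ s)
    (hs1 : s ≤ 1) (hsL : s ≤ L / (5 * κ * R)) (hw0 : 0 ≤ w) (hw : w ≤ Cm * R ^ ν) :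
    (c * (R ^ (-δ) * Real.exp (γ * L))) ^ (1 - s) * w ^ s ≤
      max 1 c * max 1 Cm * Real.exp (4 * (δ + ν) ^ 2 / (5 * γ * κ)) *
        (R ^ (-δ) * Real.exp (γ * L)) := by
  have hR0 : 0 < R := by linarith
  have hl : 0 ≤ Real.log R := Real.log_nonneg hR
  set X := R ^ (-δ) * Real.exp (γ * L) with hX
  have hX0 : 0 < X := by positivity
  have hexp : s * ((δ + ν) * Real.log R - γ * L) ≤ 4 * (δ + ν) ^ 2 / (5 * γ * κ) := by
    have hpos : 0 ≤ 4 * (δ + ν) ^ 2 / (5 * γ * κ) := by positivity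
    rcases le_total ((δ + ν) * Real.log R) (γ * L) with hle | hle
    · exact (mul_nonpos_of_nonneg_of_nonpos hs0 (by linarith)).trans hpos
    · have hL' : L ≤ (δ + ν) * Real.log R / γ := by
        rw [le_div_iff₀ hγ]; linarith
      calc s * ((δ + ν) * Real.log R - γ * L) ≤ s * ((δ + ν) * Real.log R) := by
            gcongr; nlinarith
        _ ≤ L / (5 * κ * R) * ((δ + ν) * Real.log R) := by gcongr
        _ ≤ ((δ + ν) * Real.log R / γ) / (5 * κ * R) * ((δ + ν) * Real.log R) := by gcongr
        _ = (δ + ν) ^ 2 / (5 * γ * κ) * (Real.log R ^ 2 / R) := by field_simp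
        _ ≤ (δ + ν) ^ 2 / (5 * γ * κ) * 4 := by
            gcongr
            rw [div_le_iff₀ hR0]
            exact sq_log_le hR
        _ = _ := by ring
  have hXs : X ^ (-s) * (R ^ ν) ^ s = Real.exp (s * ((δ + ν) * Real.log R - γ * L)) := by
    rw [hX, Real.mul_rpow (by positivity) (by positivity), ← Real.exp_mul,
      ← Real.rpow_mul hR0.le, ← Real.rpow_mul hR0.le, Real.rpow_def_of_pos hR0,
      Real.rpow_def_of_pos hR0, ← Real.exp_add, ← Real.exp_add]
    congr 1
    ring
  calc (c * X) ^ (1 - s) * w ^ s ≤ (c * X) ^ (1 - s) * (Cm * R ^ ν) ^ s := by gcongr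
    _ = c ^ (1 - s) * Cm ^ s * (X ^ (-s) * (R ^ ν) ^ s) * X := by
        rw [Real.mul_rpow hc hX0.le, Real.mul_rpow hCm (by positivity), sub_eq_add_neg,
          Real.rpow_add hX0, Real.rpow_one]
        ring
    _ ≤ max 1 c * max 1 Cm * Real.exp (4 * (δ + ν) ^ 2 / (5 * γ * κ)) * X := by
        rw [hXs]
        gcongr
        · exact rpow_le_max_one hc (by linarith) (by linarith)
        · exact rpow_le_max_one hCm hs0 hs1

/-- Every `l ∈ (0, 1]` is brought into `[1, 2]` by a power of `a ∈ (1, 2]`. -/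
lemma exists_pow_mul_mem_Icc {a l : ℝ} (ha1 : 1 < a) (ha2 : a ≤ 2) (hl0 : 0 < l) (hl1 : l ≤ 1) :
    ∃ k : ℕ, 1 ≤ a ^ k * l ∧ a ^ k * l ≤ 2 := by
  obtain ⟨n, hn1, hn2⟩ := exists_nat_pow_near ((one_le_div hl0).2 hl1) ha1
  rw [le_div_iff₀ hl0] at hn1
  rw [div_lt_iff₀ hl0] at hn2
  refine ⟨n + 1, hn2.le, ?_⟩
  rw [pow_succ]
  nlinarith

variable {ι : Type*} [Fintype ι] [DecidableEq ι] {Q : Matrix ι ι ℝ} {m : ι → ℝ} {b : ℝ}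

namespace IsRevGen

/-- Weighted `ℓ²`-bounds for the heat kernels with poles `x` and `y` yield a pointwise bound. -/
lemma exp_add_apply_le (h : IsRevGen Q m b) {τ : ℝ} (hτ : 0 ≤ τ) {x y : ι} {φ ψ : ι → ℝ}
    {s M : ℝ} (hs : ∀ z, s ≤ φ z + ψ z) (hx : weightedHeat Q m x φ τ ≤ M)
    (hy : weightedHeat Q m y ψ τ ≤ M) :
    NormedSpace.exp ((τ + τ) • Q) x y ≤ M * Real.exp (-s) * m y := by
  have hmy := h.pos y
  have hterm : ∀ z, NormedSpace.exp (τ • Q) x z * NormedSpace.exp (τ • Q) z y ≤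
      Real.exp (-s) * m y * ((m z * (Real.exp (φ z) * heatDens Q m x τ z) ^ 2 +
        m z * (Real.exp (ψ z) * heatDens Q m y τ z) ^ 2) / 2) := by
    intro z
    have hu := h.heatDens_nonneg x hτ z
    have hv := h.heatDens_nonneg y hτ z
    have hmz := h.pos z
    have h1 : NormedSpace.exp (τ • Q) x z = m z * heatDens Q m x τ z := by
      have := h.exp_symm τ x z
      have hp := (h.pos x).ne'
      rw [heatDens, mul_div_assoc', ← this]
      field_simp
    have h2 : NormedSpace.exp (τ • Q) z y = heatDens Q m y τ z * m y := by
      rw [heatDens, div_mul_cancel₀ _ hmy.ne']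
    have h3 : 1 ≤ Real.exp (-s) * (Real.exp (φ z) * Real.exp (ψ z)) := by
      rw [← Real.exp_add, ← Real.exp_add]
      exact Real.one_le_exp (by linarith [hs z])
    rw [h1, h2]
    calc m z * heatDens Q m x τ z * (heatDens Q m y τ z * m y)
        ≤ (m z * heatDens Q m x τ z * (heatDens Q m y τ z * m y)) *
          (Real.exp (-s) * (Real.exp (φ z) * Real.exp (ψ z))) :=
          le_mul_of_one_le_right (by positivity) h3
      _ = Real.exp (-s) * m y * (m z * ((Real.exp (φ z) * heatDens Q m x τ z) *
          (Real.exp (ψ z) * heatDens Q m y τ z))) := by ring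
      _ ≤ Real.exp (-s) * m y * (m z * (((Real.exp (φ z) * heatDens Q m x τ z) ^ 2 +
          (Real.exp (ψ z) * heatDens Q m y τ z) ^ 2) / 2)) := by
          gcongr
          linarith [two_mul_le_add_sq (Real.exp (φ z) * heatDens Q m x τ z)
            (Real.exp (ψ z) * heatDens Q m y τ z)]
      _ = _ := by ring
  rw [exp_smul_add_apply]
  calc ∑ z, NormedSpace.exp (τ • Q) x z * NormedSpace.exp (τ • Q) z y
      ≤ ∑ z, Real.exp (-s) * m y * ((m z * (Real.exp (φ z) * heatDens Q m x τ z) ^ 2 +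
        m z * (Real.exp (ψ z) * heatDens Q m y τ z) ^ 2) / 2) :=
        Finset.sum_le_sum fun z _ => hterm z
    _ = Real.exp (-s) * m y * ((weightedHeat Q m x φ τ + weightedHeat Q m y ψ τ) / 2) := by
        rw [← Finset.mul_sum, ← Finset.sum_div, Finset.sum_add_distrib]
        rfl
    _ ≤ Real.exp (-s) * m y * M := by
        gcongr
        linarith
    _ = _ := by ring

/-- The weighted `ℓ²`-norm of the heat kernel at time `t / 2`, with weight of slope
`log (R² / t) / (5 κ R)`, satisfies the on-diagonal bound. -/
lemma weightedHeat_le (h : IsRevGen Q m b) (hb : 0 ≤ b) (x₀ : ι) {φ : ι → ℝ}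
    {S C Cm δ ν κ R t : ℝ} (hS : 2 < S) (hC : 0 < C) (hCm : 0 < Cm) (hδν : 0 ≤ δ + ν)
    (hκ : 0 < κ) (hR : 1 ≤ R) (hκR : 1 ≤ κ * R) (ht : 0 < t) (htR : t < R ^ 2)
    (hSob : SobolevIneq Q m S (C * R ^ (2 - δ + 2 * δ / S)) (1 / R ^ 2))
    (hm : 1 / m x₀ ≤ Cm * R ^ ν)
    (hφ : JumpLip Q φ (Real.log (R ^ 2 / t) / (5 * κ * R))) (hφ0 : φ x₀ = 0) :
    weightedHeat Q m x₀ φ (t / 2) ≤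
      Real.exp (2 * b * S / κ ^ 2) *
        (max 1 ((Real.exp 1 * 2 ^ (S / (S - 2)) * (2 * C)) ^ (S / (S - 2))) * max 1 Cm *
          Real.exp (4 * (δ + ν) ^ 2 / (5 * (S / (S - 2)) * κ))) *
        (R ^ (-δ) * Real.exp (S / (S - 2) * Real.log (R ^ 2 / t))) := by
  have hR0 : 0 < R := by linarith
  have hmx := h.pos x₀
  have hL : 0 < Real.log (R ^ 2 / t) := Real.log_pos ((one_lt_div ht).2 htR)
  have htL : t = R ^ 2 * Real.exp (-Real.log (R ^ 2 / t)) := by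
    rw [Real.exp_neg, Real.exp_log (by positivity)]
    field_simp
  have heL : Real.exp (Real.log (R ^ 2 / t)) = R ^ 2 / t := Real.exp_log (by positivity)
  have hγ : 0 < S / (S - 2) := div_pos (by linarith) (by linarith)
  set L := Real.log (R ^ 2 / t) with hLdef
  set γ := S / (S - 2) with hγdef
  set l := L / (5 * κ * R) with hldef
  have hl0 : 0 < l := by positivity
  set c := (Real.exp 1 * 2 ^ γ * (2 * C)) ^ γ with hcdef
  have hc : 0 ≤ c := by positivity
  have hw0 : 0 ≤ 1 / m x₀ := by positivity
  suffices hsuff : ∃ s : ℝ, 0 ≤ s ∧ s ≤ 1 ∧ s ≤ l ∧ weightedHeat Q m x₀ φ (t / 2) ≤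
      Real.exp (2 * b * S / κ ^ 2) *
        ((c * (R ^ (-δ) * Real.exp (γ * L))) ^ (1 - s) * (1 / m x₀) ^ s) by
    obtain ⟨s, hs0, hs1, hsl, hle⟩ := hsuff
    exact hle.trans (le_of_le_of_eq (mul_le_mul_of_nonneg_left
      (interpolation_le hc hCm.le hδν hγ hκ hR hL.le hs0 hs1 hsl hw0 hm) (Real.exp_pos _).le)
      (mul_assoc _ _ _).symm)
  rcases le_or_gt 1 l with hl1 | hl1
  · refine ⟨1, zero_le_one, le_rfl, hl1, ?_⟩
    have hgrow := h.weightedHeat_growth hb x₀ hφ le_rfl (by positivity : (0 : ℝ) ≤ t / 2)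
    rw [h.weightedHeat_zero hφ0] at hgrow
    rw [sub_self, Real.rpow_zero, one_mul, Real.rpow_one]
    refine hgrow.trans ?_
    gcongr
    have hcosh : Real.cosh l - 1 ≤ Real.exp l := by
      rw [Real.cosh_eq]
      have : Real.exp (-l) ≤ Real.exp l := Real.exp_le_exp.2 (by linarith)
      linarith
    have hlL : l ≤ L / 5 := by
      rw [hldef]
      gcongr
      linarith
    have hRL : κ * R ≤ L / 5 := by
      rw [hldef, one_le_div (by positivity)] at hl1
      linarith
    have hte : t * Real.exp l ≤ 1 / κ ^ 2 := by
      have h4 := sq_mul_exp_neg_le (by positivity : 0 ≤ 4 / 5 * L)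
      rw [le_div_iff₀ (by positivity)]
      calc t * Real.exp l * κ ^ 2
          = (κ * R) ^ 2 * (Real.exp (-L) * Real.exp l) := by
            nth_rewrite 1 [htL]; ring
        _ ≤ (L / 5) ^ 2 * (Real.exp (-L) * Real.exp (L / 5)) := by gcongr
        _ = (1 / 16) * ((4 / 5 * L) ^ 2 * Real.exp (-(4 / 5 * L))) := by
            rw [← Real.exp_add, show -L + L / 5 = -(4 / 5 * L) by ring]; ring
        _ ≤ 1 := by linarith
    calc 2 * b * (Real.cosh l - 1) * (t / 2 - 0) ≤ 2 * b * Real.exp l * (t / 2 - 0) := by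
          rw [sub_zero]; gcongr
      _ = b * (t * Real.exp l) := by ring
      _ ≤ b * (1 / κ ^ 2) := by gcongr
      _ ≤ (2 * S) * (b * (1 / κ ^ 2)) := le_mul_of_one_le_left (by positivity) (by linarith)
      _ = 2 * b * S / κ ^ 2 := by ring
  · have ha1 : 1 < 2 * (S - 1) / S := by rw [one_lt_div (by linarith)]; linarith
    have ha2 : 2 * (S - 1) / S ≤ 2 := by rw [div_le_iff₀ (by linarith)]; linarith
    obtain ⟨k, hk1, hk2⟩ := exists_pow_mul_mem_Icc ha1 ha2 hl0 hl1.le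
    have hinv : S / (2 * (S - 1)) = (2 * (S - 1) / S)⁻¹ := (inv_div _ _).symm
    have hak : 0 < (2 * (S - 1) / S) ^ k := by positivity
    have hA : 0 < C * R ^ (2 - δ + 2 * δ / S) := by positivity
    have hit := h.weightedHeat_iterate hb x₀ hS hA (by positivity) hSob k hφ hφ0 hl0.le hk2
      (by positivity : 0 < t / 2) (by rw [one_div_mul_eq_div, div_le_one (by positivity)]; linarith)
    have hs0 : 0 ≤ (S / (2 * (S - 1))) ^ k := by rw [hinv]; positivity
    refine ⟨(S / (2 * (S - 1))) ^ k, hs0, ?_, ?_, ?_⟩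
    · rw [hinv, inv_pow]
      exact inv_le_one_of_one_le₀ (one_le_pow₀ ha1.le)
    · rw [hinv, inv_pow, inv_le_iff_one_le_mul₀' hak]
      exact hk1
    · refine hit.trans ?_
      have hbase : (Real.exp 1 * 2 ^ γ * (C * R ^ (2 - δ + 2 * δ / S)) / (t / 2)) ^ γ =
          c * (R ^ (-δ) * Real.exp (γ * L)) := by
        have hexpo : (2 - δ + 2 * δ / S - 2) * γ = -δ := by
          have h1 : S - 2 ≠ 0 := by linarith
          have h2 : S ≠ 0 := by linarith
          rw [hγdef]
          field_simp
          ring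
        have hR2 : R ^ (2 - δ + 2 * δ / S) = R ^ (2 - δ + 2 * δ / S - 2) * R ^ 2 := by
          rw [← Real.rpow_natCast R 2, ← Real.rpow_add hR0]
          norm_num
        have hsplit : Real.exp 1 * 2 ^ γ * (C * R ^ (2 - δ + 2 * δ / S)) / (t / 2) =
            Real.exp 1 * 2 ^ γ * (2 * C) * (R ^ (2 - δ + 2 * δ / S - 2) * Real.exp L) := by
          rw [hR2, heL]
          field_simp
        rw [hsplit, Real.mul_rpow (by positivity) (by positivity), ← hcdef,
          Real.mul_rpow (by positivity) (by positivity), ← Real.rpow_mul hR0.le, hexpo,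
          ← Real.exp_mul, mul_comm L γ]
      rw [Real.rpow_mul (by positivity), hbase, mul_right_comm, mul_comm]
      gcongr
      have h4 := sq_mul_exp_neg_le hL.le
      calc 48 * b * S * (t / 2) * l ^ 2
          = 48 / 50 * (b * S / κ ^ 2) * (L ^ 2 * Real.exp (-L)) := by
            rw [hldef]; nth_rewrite 1 [htL]; field_simp; ring
        _ ≤ 48 / 50 * (b * S / κ ^ 2) * 2 := by gcongr
        _ ≤ 2 * (b * S / κ ^ 2) := by
            have : 0 ≤ b * S / κ ^ 2 := by positivity
            linarith
        _ = _ := by ring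

end IsRevGen

end Assembly

/-- STATEMENT 19 (Proposition 7.2): off-diagonal heat-kernel bound for the
localized chain `Y^R`. -/
theorem statement19 (d : ℕ) (hd : 2 ≤ d) (p q : ℝ)
    (hp : (d : ℝ) / 2 < p) (hq : (d : ℝ) / 2 < q) (hpq : 1 / p + 1 / q < 2 / (d : ℝ))
    (κ : ℝ) (hκ0 : 0 < κ) (hκ1 : κ ≤ 1)
    (ω : EnvSp d) (hmom : InOmegaPQ d p q ω) :
    ∃ c₃ : ℝ, 0 < c₃ ∧
      ∀ R : ℝ, 1 ≤ R → 1 ≤ κ * R → ∀ t : ℝ, 0 < t → t < R ^ 2 → ∀ x y : Vert d,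
        hkR d ω R t x y ≤
          c₃ * R ^ (-(d : ℝ)) * (t / R ^ 2) ^ (-(2 + epsPQ d p q) / epsPQ d p q) *
            Real.exp (-(l1 d (x - y) / (5 * κ * R)) * Real.log (R ^ 2 / t)) *
            piRloc d ω R y := by
  obtain ⟨-, hq1, hε, -⟩ := sobolev_exponent_facts hd hp hq hpq
  have hq0 : 0 < q := by linarith
  obtain ⟨C, hC, hSob⟩ := exists_sobolevIneq_killedGen hd hp hq hpq hmom
  obtain ⟨Cm, hCm, hm⟩ := exists_one_div_piRloc_le hd hq0 hmom
  set ε := epsPQ d p q with hεdef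
  have hγ : (2 + ε) / (2 + ε - 2) = (2 + ε) / ε := by rw [add_sub_cancel_left]
  obtain ⟨c₃, hc₃⟩ : ∃ c : ℝ, c = Real.exp (2 * (2 * d) * (2 + ε) / κ ^ 2) *
      (max 1 ((Real.exp 1 * 2 ^ ((2 + ε) / (2 + ε - 2)) * (2 * C)) ^ ((2 + ε) / (2 + ε - 2))) *
        max 1 Cm * Real.exp (4 * (d + d / q) ^ 2 / (5 * ((2 + ε) / (2 + ε - 2)) * κ))) := ⟨_, rfl⟩
  refine ⟨c₃, by rw [hc₃]; positivity, fun R hR hκR t ht htR x y =>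
    hkR_le_of_killedGen hd ω hR ht.le x y fun B hx hy => ?_⟩
  have hR0 : 0 < R := by linarith
  have hL : 0 < Real.log (R ^ 2 / t) := Real.log_pos ((one_lt_div ht).2 htR)
  have h := isRevGen_killedGen hd ω hR B
  have hpow : (t / R ^ 2) ^ (-(2 + ε) / ε) =
      Real.exp ((2 + ε) / (2 + ε - 2) * Real.log (R ^ 2 / t)) := by
    rw [hγ, Real.rpow_def_of_pos (by positivity), ← inv_div (R ^ 2) t, Real.log_inv]
    congr 1
    ring
  have hbound : ∀ w : B, weightedHeat (killedGen d ω R B) (fun x => piRloc d ω R x) w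
      (fun z => Real.log (R ^ 2 / t) / (5 * κ * R) * l1 d ((z : Vert d) - w)) (t / 2) ≤
        c₃ * (R ^ (-(d : ℝ)) * Real.exp ((2 + ε) / (2 + ε - 2) * Real.log (R ^ 2 / t))) :=
    fun w => hc₃ ▸ h.weightedHeat_le (by positivity) w (φ := fun z =>
      Real.log (R ^ 2 / t) / (5 * κ * R) * l1 d ((z : Vert d) - w)) (by linarith) hC hCm
      (δ := d) (ν := (d : ℝ) / q) (by positivity) hκ0 hR hκR ht htR (hSob R hR B)
      (hm R hR w)
      (jumpLip_killedGen ω R B (φ := fun z => Real.log (R ^ 2 / t) / (5 * κ * R) *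
        l1 d (z - w)) fun a a' => by
        rw [← mul_sub, abs_mul, abs_of_nonneg (by positivity)]
        gcongr
        rw [abs_le]
        have h1 := l1_add_le (a - a') (a' - (w : Vert d))
        have h2 := l1_add_le (a' - a) (a - (w : Vert d))
        have h3 := l1_neg (a - a')
        rw [neg_sub] at h3
        rw [sub_add_sub_cancel] at h1 h2
        constructor <;> linarith)
      (by simp [l1])
  have hfin := h.exp_add_apply_le (by positivity : 0 ≤ t / 2)
    (s := l1 d (x - y) / (5 * κ * R) * Real.log (R ^ 2 / t)) (fun z => ?_)
    (hbound ⟨x, hx⟩) (hbound ⟨y, hy⟩)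
  · rw [add_halves] at hfin
    rw [hpow, mul_assoc _ (R ^ (-(d : ℝ))), neg_mul]
    exact hfin
  · have h1 := l1_add_le (x - (z : Vert d)) ((z : Vert d) - y)
    have h3 := l1_neg (x - (z : Vert d))
    rw [neg_sub] at h3
    rw [sub_add_sub_cancel] at h1
    have h4 : l1 d (x - y) ≤ l1 d ((z : Vert d) - x) + l1 d ((z : Vert d) - y) := by linarith
    rw [← mul_add, div_mul_eq_mul_div, div_mul_eq_mul_div, mul_comm]
    gcongr

end DetCond
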